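/- Complete summation formula in profile form: let h ≥ 1, let δ=(δ_1,...,δ_h) be a profile, and let Z^1,...,Z^h be alphabets; set Z = Z^1+...+Z^h, Z_-^δ = Σ_{i: δ_i=−1} Z^i and Z_+^δ = Σ_{i: δ_i=1} Z^i. For partitions λ^0,...,λ^h let s_i^δ denote s_{λ^i/λ^{i−1}} if δ_i=1 and s_{λ^{i−1}/λ^i} if δ_i=−1. Then Σ_{λ^0,...,λ^h} z^{|λ^h|} ∏_{i=1}^h s_i^δ(Z^i) = ∏_{1≤i<j≤h, δ_i>δ_j} Ψ(Z^i,Z^j) · Φ(Z_-^δ) · ∏_{k≥1} Φ(z^k Z)/(1−z^k), as an identity of formal power series, where z^k Z denotes the alphabet Z with every variable multiplied by z^k. -/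

import Mathlib

open scoped BigOperators

/-- An integer partition: a weakly decreasing, finitely supported sequence of
nonnegative integers. -/
structure Ptn where
  toFun : ℕ →₀ ℕ
  antitone' : ∀ ⦃i j : ℕ⦄, i ≤ j → toFun j ≤ toFun i

namespace Ptn
/-- the `i`-th part (0-indexed) -/
def part (lam : Ptn) (i : ℕ) : ℕ := lam.toFun i
/-- the size `|λ|` -/
def size (lam : Ptn) : ℕ := lam.toFun.sum fun _ k => k
end Ptn

/-- `HStrip μ λ` means `μ ≺ λ`, i.e. `λ/μ` is a horizontal strip:
`λ_i ≥ μ_i ≥ λ_{i+1}` for all `i`. -/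
def HStrip (mu lam : Ptn) : Prop :=
  ∀ i : ℕ, mu.part i ≤ lam.part i ∧ lam.part (i + 1) ≤ mu.part i
/-- Chains of partitions `μ = c 0 ≺ c 1 ≺ ⋯` stabilizing at `λ`; these encode
semistandard Young tableaux of shape `λ/μ` with entries in `{0, 1, 2, …}`. -/
def IsSchurChain (mu lam : Ptn) (c : ℕ → Ptn) : Prop :=
  c 0 = mu ∧ (∀ i, HStrip (c i) (c (i + 1))) ∧ ∃ N, ∀ i, N ≤ i → c i = lam

/-- the monomial attached to a chain: the variable `X i` records the cells added
at step `i` of the chain -/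
noncomputable def chainWeight {R : Type*} [CommRing R] (X : ℕ → R) (c : ℕ → Ptn) : R :=
  ∏ᶠ i : ℕ, X i ^ ((c (i + 1)).size - (c i).size)

/-- the skew Schur function `s_{λ/μ}(X)` (which is `0` if `μ ⊄ λ`) -/
noncomputable def skewSchur {R : Type*} [CommRing R] [TopologicalSpace R]
    (X : ℕ → R) (lam mu : Ptn) : R :=
  ∑' c : {c : ℕ → Ptn // IsSchurChain mu lam c}, chainWeight X c.1

/-- `Ψ(X,Y) = ∏_{i,j} (1 - x_i y_j)⁻¹` -/
noncomputable def Psi {R : Type*} [CommRing R] [TopologicalSpace R] [Inv R] (X Y : ℕ → R) : R :=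
  ∏' p : ℕ × ℕ, (1 - X p.1 * Y p.2)⁻¹

/-- `Φ(X) = ∏_i (1 - x_i)⁻¹ ∏_{i<j} (1 - x_i x_j)⁻¹` -/
noncomputable def Phi {R : Type*} [CommRing R] [TopologicalSpace R] [Inv R] (X : ℕ → R) : R :=
  (∏' i : ℕ, (1 - X i)⁻¹) * ∏' p : {q : ℕ × ℕ // q.1 < q.2}, (1 - X p.1.1 * X p.1.2)⁻¹
/-- the coefficientwise (product) topology on multivariate formal power series -/
instance (σ : Type*) : TopologicalSpace (MvPowerSeries σ ℚ) :=
  inferInstanceAs (TopologicalSpace ((σ →₀ ℕ) → ℚ))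

/-- the ambient ring: formal power series in the independent variables
`z^{(i)}_n` (`i, n ∈ ℕ`) and `z` -/
abbrev RZ : Type := MvPowerSeries ((ℕ × ℕ) ⊕ Unit) ℚ

/-- the extra formal variable `z` -/
noncomputable def z : RZ := MvPowerSeries.X (Sum.inr ())

/-- the alphabet `Z^i = {z^{(i)}_0, z^{(i)}_1, …}` -/
noncomputable def Za (i n : ℕ) : RZ := MvPowerSeries.X (Sum.inl (i, n))

/-- `Z^δ_- = Σ_{i : δ_i = -1} Z^i`, the union of the alphabets `Z^i` with
`δ_i = -1` (the remaining entries being `0`) -/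
noncomputable def Zminus (h : ℕ) (δ : ℕ → ℤ) : ℕ → RZ :=
  fun n => if δ (n % h + 1) = -1 then Za (n % h + 1) (n / h) else 0

/-- `Z^δ_+ = Σ_{i : δ_i = 1} Z^i`, the union of the alphabets `Z^i` with
`δ_i = 1` (the remaining entries being `0`) -/
noncomputable def Zplus (h : ℕ) (δ : ℕ → ℤ) : ℕ → RZ :=
  fun n => if δ (n % h + 1) = 1 then Za (n % h + 1) (n / h) else 0

/-- `Z = Z^1 + ⋯ + Z^h`, the union of all the alphabets `Z^1, …, Z^h` -/
noncomputable def Zall (h : ℕ) : ℕ → RZ :=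
  fun n => Za (n % h + 1) (n / h)

/-- `δ` is a `±1`-profile on the indices `1, …, h` -/
def IsProfile (h : ℕ) (δ : ℕ → ℤ) : Prop := ∀ i, 1 ≤ i → i ≤ h → δ i = 1 ∨ δ i = -1

section helpers

open scoped ENNReal
open MvPowerSeries

/-! ### Power series with extended nonnegative coefficients -/

/-- The coefficientwise sum of a family of power series with coefficients in `[0, ∞]`. -/
noncomputable def formalSum {σ ι : Type*} (f : ι → MvPowerSeries σ ℝ≥0∞) : MvPowerSeries σ ℝ≥0∞ :=
  fun d => ∑' i, coeff d (f i)

section formalSum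

variable {σ ι κ : Type*}

theorem coeff_formalSum (f : ι → MvPowerSeries σ ℝ≥0∞) (d : σ →₀ ℕ) :
    coeff d (formalSum f) = ∑' i, coeff d (f i) := rfl

theorem formalSum_mul_left (a : MvPowerSeries σ ℝ≥0∞) (f : ι → MvPowerSeries σ ℝ≥0∞) :
    (formalSum fun i => a * f i) = a * formalSum f := by
  classical
  ext d
  simp only [coeff_formalSum, coeff_mul]
  rw [Summable.tsum_finsetSum fun _ _ => ENNReal.summable]
  simp only [ENNReal.tsum_mul_left]

theorem formalSum_mul_right (a : MvPowerSeries σ ℝ≥0∞) (f : ι → MvPowerSeries σ ℝ≥0∞) :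
    (formalSum fun i => f i * a) = formalSum f * a := by
  simp only [mul_comm _ a, formalSum_mul_left]

theorem formalSum_comm (f : ι → κ → MvPowerSeries σ ℝ≥0∞) :
    (formalSum fun i => formalSum fun j => f i j) = formalSum fun j => formalSum fun i => f i j := by
  ext d
  simp only [coeff_formalSum]
  exact ENNReal.tsum_comm

theorem formalSum_sigma {β : ι → Type*} (f : (Σ i, β i) → MvPowerSeries σ ℝ≥0∞) :
    formalSum f = formalSum fun i => formalSum fun j => f ⟨i, j⟩ := by
  ext d
  simp only [coeff_formalSum]
  exact ENNReal.tsum_sigma' _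

theorem formalSum_prod (f : ι × κ → MvPowerSeries σ ℝ≥0∞) :
    formalSum f = formalSum fun i => formalSum fun j => f (i, j) := by
  ext d
  simp only [coeff_formalSum]
  exact ENNReal.tsum_prod'

theorem formalSum_equiv (e : ι ≃ κ) (f : κ → MvPowerSeries σ ℝ≥0∞) :
    (formalSum fun i => f (e i)) = formalSum f := by
  ext d
  simp only [coeff_formalSum]
  exact e.tsum_eq fun j => coeff d (f j)

theorem formalSum_ite (p : ι → Prop) [DecidablePred p] (f : ι → MvPowerSeries σ ℝ≥0∞) :
    (formalSum fun i => if p i then f i else 0) = formalSum fun i : {i // p i} => f i := by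
  ext d
  simp only [coeff_formalSum]
  refine Eq.trans ?_ (tsum_subtype {i | p i} fun i => coeff d (f i)).symm
  congr 1
  ext i
  by_cases h : p i <;> simp [h]

theorem formalSum_eq_single (f : ι → MvPowerSeries σ ℝ≥0∞) (i : ι) (h : ∀ j, j ≠ i → f j = 0) :
    formalSum f = f i := by
  ext d
  rw [coeff_formalSum]
  exact tsum_eq_single i fun j hj => by simp [h j hj]

end formalSum

/-- The geometric series `∑ fⁿ`. -/
noncomputable def geom {σ : Type*} (f : MvPowerSeries σ ℝ≥0∞) : MvPowerSeries σ ℝ≥0∞ :=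
  formalSum fun n : ℕ => f ^ n

section geom

variable {σ : Type*}

theorem geom_eq_one_add (f : MvPowerSeries σ ℝ≥0∞) : geom f = 1 + geom f * f := by
  rw [geom, ← formalSum_mul_right]
  ext d
  rw [map_add, coeff_formalSum, coeff_formalSum, tsum_eq_zero_add' ENNReal.summable]
  simp [pow_succ]

theorem geom_zero : geom (0 : MvPowerSeries σ ℝ≥0∞) = 1 := by
  rw [geom_eq_one_add, mul_zero, add_zero]

theorem coeff_geom_ne_top {f : MvPowerSeries σ ℝ≥0∞} (hf : ∀ d, coeff d f ≠ ⊤)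
    (h0 : constantCoeff f = 0) (d : σ →₀ ℕ) : coeff d (geom f) ≠ ⊤ := by
  classical
  have hpow : ∀ (n : ℕ) d, coeff d (f ^ n) ≠ ⊤ := by
    intro n
    induction n with
    | zero => intro d; rw [pow_zero, coeff_one]; split_ifs <;> simp
    | succ n ih =>
      intro d
      rw [pow_succ, coeff_mul]
      exact ENNReal.sum_ne_top.2 fun p _ => ENNReal.mul_ne_top (ih _) (hf _)
  rw [geom, coeff_formalSum, tsum_eq_sum (s := Finset.range (d.degree + 1))]
  · exact ENNReal.sum_ne_top.2 fun n _ => hpow n d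
  · intro n hn
    refine coeff_eq_zero_of_constantCoeff_nilpotent (m := 1) (by simpa using h0) ?_
    simp at hn
    omega

end geom

/-- Two power series agree in all multidegrees dividing the monomial of exponent `m`. -/
def AgreeUpTo {σ R : Type*} [Semiring R] (m : σ →₀ ℕ) (f g : MvPowerSeries σ R) : Prop :=
  ∀ d ≤ m, coeff d f = coeff d g

namespace AgreeUpTo

variable {σ ι R : Type*} {m : σ →₀ ℕ}

theorem refl [Semiring R] (f : MvPowerSeries σ R) : AgreeUpTo m f f := fun _ _ => rfl

theorem symm [Semiring R] {f g : MvPowerSeries σ R} (h : AgreeUpTo m f g) : AgreeUpTo m g f :=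
  fun d hd => (h d hd).symm

theorem trans [Semiring R] {f g k : MvPowerSeries σ R} (h : AgreeUpTo m f g)
    (h' : AgreeUpTo m g k) : AgreeUpTo m f k := fun d hd => (h d hd).trans (h' d hd)

theorem mul [Semiring R] {f f' g g' : MvPowerSeries σ R} (h : AgreeUpTo m f f')
    (h' : AgreeUpTo m g g') : AgreeUpTo m (f * g) (f' * g') := by
  classical
  intro d hd
  rw [coeff_mul, coeff_mul]
  refine Finset.sum_congr rfl fun p hp => ?_
  rw [Finset.HasAntidiagonal.mem_antidiagonal] at hp
  rw [h p.1 (le_trans (by rw [← hp]; exact le_self_add) hd),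
    h' p.2 (le_trans (by rw [← hp]; exact le_add_self) hd)]

theorem pow [Semiring R] {f g : MvPowerSeries σ R} (h : AgreeUpTo m f g) (n : ℕ) :
    AgreeUpTo m (f ^ n) (g ^ n) := by
  induction n with
  | zero => simpa using refl 1
  | succ n ih => simpa only [pow_succ] using ih.mul h

theorem prod [CommSemiring R] {f g : ι → MvPowerSeries σ R} (s : Finset ι)
    (h : ∀ i ∈ s, AgreeUpTo m (f i) (g i)) : AgreeUpTo m (∏ i ∈ s, f i) (∏ i ∈ s, g i) := by
  classical
  induction s using Finset.induction_on with
  | empty => simpa using refl 1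
  | insert i s hi ih =>
    rw [Finset.prod_insert hi, Finset.prod_insert hi]
    exact (h i (by simp)).mul (ih fun j hj => h j (by simp [hj]))

theorem formalSum {f g : ι → MvPowerSeries σ ℝ≥0∞} (h : ∀ i, AgreeUpTo m (f i) (g i)) :
    AgreeUpTo m (formalSum f) (formalSum g) := by
  intro d hd
  rw [coeff_formalSum, coeff_formalSum]
  exact tsum_congr fun i => h i d hd

theorem one_sub {f g : MvPowerSeries σ ℚ} (h : AgreeUpTo m f g) :
    AgreeUpTo m (1 - f) (1 - g) := by
  intro d hd
  rw [map_sub, map_sub, h d hd]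

theorem X_pow_zero [Semiring R] {s : σ} {n : ℕ} (h : m s < n) :
    AgreeUpTo m (X s ^ n : MvPowerSeries σ R) 0 := by
  classical
  intro d hd
  rw [coeff_X_pow, if_neg, map_zero]
  rintro rfl
  have := hd s
  simp at this
  omega

theorem X_zero [Semiring R] {s : σ} (h : m s = 0) : AgreeUpTo m (X s : MvPowerSeries σ R) 0 := by
  simpa using X_pow_zero (R := R) (n := 1) (s := s) (m := m) (by omega)

theorem mul_zero [Semiring R] {f g : MvPowerSeries σ R} (h : AgreeUpTo m g 0) :
    AgreeUpTo m (f * g) 0 := by simpa using (refl f).mul h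

theorem zero_mul [Semiring R] {f g : MvPowerSeries σ R} (h : AgreeUpTo m f 0) :
    AgreeUpTo m (f * g) 0 := by simpa using h.mul (refl g)

end AgreeUpTo

/-- `f` and `g` are the images in `ℚ` and `[0, ∞]` of one power series over `ℕ`. -/
def SameNatSeries {σ : Type*} (f : MvPowerSeries σ ℚ) (g : MvPowerSeries σ ℝ≥0∞) : Prop :=
  ∃ p : MvPowerSeries σ ℕ, map (Nat.castRingHom ℚ) p = f ∧ map (Nat.castRingHom ℝ≥0∞) p = g

namespace SameNatSeries

variable {σ ι : Type*}

theorem coeff_ne_top {f : MvPowerSeries σ ℚ} {g : MvPowerSeries σ ℝ≥0∞} (h : SameNatSeries f g)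
    (d : σ →₀ ℕ) : coeff d g ≠ ⊤ := by
  obtain ⟨p, rfl, rfl⟩ := h
  simp

theorem coeff_eq_of_coeff_eq {f f' : MvPowerSeries σ ℚ} {g g' : MvPowerSeries σ ℝ≥0∞}
    (h : SameNatSeries f g) (h' : SameNatSeries f' g') {d : σ →₀ ℕ}
    (hd : coeff d g = coeff d g') : coeff d f = coeff d f' := by
  obtain ⟨p, rfl, rfl⟩ := h
  obtain ⟨p', rfl, rfl⟩ := h'
  simp only [coeff_map, eq_natCast, Nat.cast_inj] at hd ⊢
  exact hd

theorem zero : SameNatSeries (0 : MvPowerSeries σ ℚ) 0 := ⟨0, by simp, by simp⟩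

theorem one : SameNatSeries (1 : MvPowerSeries σ ℚ) 1 := ⟨1, by simp, by simp⟩

theorem X (s : σ) : SameNatSeries (X s : MvPowerSeries σ ℚ) (X s) :=
  ⟨MvPowerSeries.X s, by simp, by simp⟩

theorem mul {f f' : MvPowerSeries σ ℚ} {g g' : MvPowerSeries σ ℝ≥0∞}
    (h : SameNatSeries f g) (h' : SameNatSeries f' g') : SameNatSeries (f * f') (g * g') := by
  obtain ⟨p, rfl, rfl⟩ := h
  obtain ⟨p', rfl, rfl⟩ := h'
  exact ⟨p * p', by simp, by simp⟩

theorem pow {f : MvPowerSeries σ ℚ} {g : MvPowerSeries σ ℝ≥0∞}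
    (h : SameNatSeries f g) (n : ℕ) : SameNatSeries (f ^ n) (g ^ n) := by
  obtain ⟨p, rfl, rfl⟩ := h
  exact ⟨p ^ n, by simp, by simp⟩

theorem prod {f : ι → MvPowerSeries σ ℚ} {g : ι → MvPowerSeries σ ℝ≥0∞} (s : Finset ι)
    (h : ∀ i ∈ s, SameNatSeries (f i) (g i)) : SameNatSeries (∏ i ∈ s, f i) (∏ i ∈ s, g i) := by
  classical
  induction s using Finset.induction_on with
  | empty => simpa using one
  | insert i s hi ih =>
    rw [Finset.prod_insert hi, Finset.prod_insert hi]
    exact (h i (by simp)).mul (ih fun j hj => h j (by simp [hj]))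

theorem hasSum_and {f : ι → MvPowerSeries σ ℚ} {g : ι → MvPowerSeries σ ℝ≥0∞}
    (h : ∀ i, SameNatSeries (f i) (g i)) (hg : ∀ d, coeff d (formalSum g) ≠ ⊤) :
    ∃ S, HasSum f S ∧ SameNatSeries S (formalSum g) := by
  choose p hp hp' using h
  have hgp : ∀ i d, coeff d (g i) = ((coeff d (p i) : ℕ) : ℝ≥0∞) := fun i d => by simp [← hp' i]
  have hfp : ∀ i d, coeff d (f i) = ((coeff d (p i) : ℕ) : ℚ) := fun i d => by simp [← hp i]
  have hfin : ∀ d, {i | coeff d (p i) ≠ 0}.Finite := by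
    intro d
    refine (ENNReal.finite_const_le_of_tsum_ne_top (hg d) (ε := 1) (by simp)).subset fun i hi => ?_
    simp only [Set.mem_ofPred_eq, hgp] at hi ⊢
    exact_mod_cast Nat.one_le_iff_ne_zero.2 hi
  let q : MvPowerSeries σ ℕ := fun d => ∑ i ∈ (hfin d).toFinset, coeff d (p i)
  have hq : ∀ d, coeff d q = ∑ i ∈ (hfin d).toFinset, coeff d (p i) := fun _ => rfl
  refine ⟨map (Nat.castRingHom ℚ) q, ?_, q, rfl, ?_⟩
  · refine Pi.hasSum.2 fun d => ?_
    change HasSum (fun i => coeff d (f i)) (coeff d (map (Nat.castRingHom ℚ) q))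
    rw [coeff_map, hq, eq_natCast, Nat.cast_sum]
    simp only [hfp]
    refine hasSum_sum_of_ne_finset_zero fun i hi => ?_
    simpa using hi
  · ext d
    rw [coeff_map, hq, eq_natCast, Nat.cast_sum, coeff_formalSum,
      tsum_eq_sum (s := (hfin d).toFinset) fun i hi => by simpa [hgp] using hi]
    simp only [hgp]

end SameNatSeries

instance (σ : Type*) : T2Space (MvPowerSeries σ ℚ) :=
  inferInstanceAs (T2Space ((σ →₀ ℕ) → ℚ))

namespace SameNatSeries

variable {σ ι : Type*}

theorem tsum {f : ι → MvPowerSeries σ ℚ} {g : ι → MvPowerSeries σ ℝ≥0∞}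
    (h : ∀ i, SameNatSeries (f i) (g i)) (hg : ∀ d, coeff d (formalSum g) ≠ ⊤) :
    SameNatSeries (∑' i, f i) (formalSum g) := by
  obtain ⟨S, hS, hSg⟩ := hasSum_and h hg
  rwa [hS.tsum_eq]

theorem inv_one_sub {f : MvPowerSeries σ ℚ} {g : MvPowerSeries σ ℝ≥0∞} (h : SameNatSeries f g)
    (h0 : constantCoeff f = 0) : SameNatSeries (1 - f)⁻¹ (geom g) := by
  obtain ⟨p, rfl, rfl⟩ := h
  have hp0 : constantCoeff p = 0 := by simpa using h0
  have hfin := coeff_geom_ne_top (f := map (Nat.castRingHom ℝ≥0∞) p) (by simp) (by simp [hp0])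
  obtain ⟨-, -, q, -, hq⟩ := hasSum_and
    (fun n => pow ⟨p, rfl, rfl⟩ n) hfin
  refine ⟨q, ?_, hq⟩
  have hinj : Function.Injective (map (σ := σ) (Nat.castRingHom ℝ≥0∞)) := by
    intro a b hab
    ext d
    simpa using congrArg (coeff d) hab
  have hqp : q = 1 + q * p := by
    apply hinj
    rw [map_add, map_mul, map_one, hq]
    exact geom_eq_one_add _
  rw [MvPowerSeries.eq_inv_iff_mul_eq_one (by simp [hp0]), mul_sub, mul_one, ← map_mul,
    sub_eq_iff_eq_add]
  conv_lhs => rw [hqp]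
  simp

end SameNatSeries

/-! ### Partitions and horizontal strips -/

namespace Ptn

theorem part_antitone (lam : Ptn) : Antitone lam.part := fun _ _ h => lam.antitone' h

theorem ext_part {lam mu : Ptn} (h : ∀ i, lam.part i = mu.part i) : lam = mu := by
  cases lam
  cases mu
  congr
  exact Finsupp.ext h

theorem exists_part_eq_zero (lam : Ptn) : ∃ N, ∀ i, N ≤ i → lam.part i = 0 := by
  obtain ⟨N, hN⟩ := lam.toFun.support.bddAbove
  refine ⟨N + 1, fun i hi => ?_⟩
  by_contra h
  have : i ≤ N := hN (Finsupp.mem_support_iff.2 h)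
  omega

theorem size_eq_sum_range (lam : Ptn) {N : ℕ} (h : ∀ i, N ≤ i → lam.part i = 0) :
    lam.size = ∑ i ∈ Finset.range N, lam.part i := by
  refine Finsupp.sum_of_support_subset _ (fun i hi => ?_) _ (by simp)
  rw [Finset.mem_range]
  by_contra hN
  exact Finsupp.mem_support_iff.1 hi (h i (by omega))

/-- The partition with parts `f 0 ≥ f 1 ≥ ⋯`. -/
noncomputable def ofParts (f : ℕ → ℕ) (hf : ∀ i, f (i + 1) ≤ f i)
    (h0 : ∃ N, ∀ i, N ≤ i → f i = 0) : Ptn where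
  toFun := Finsupp.onFinset (Finset.range h0.choose) f fun i hi => by
    rw [Finset.mem_range]
    by_contra hN
    exact hi (h0.choose_spec i (by omega))
  antitone' := antitone_nat_of_succ_le hf

@[simp]
theorem part_ofParts (f : ℕ → ℕ) (hf : ∀ i, f (i + 1) ≤ f i)
    (h0 : ∃ N, ∀ i, N ≤ i → f i = 0) (i : ℕ) : (ofParts f hf h0).part i = f i := rfl

theorem size_le_size {mu lam : Ptn} (h : ∀ i, mu.part i ≤ lam.part i) : mu.size ≤ lam.size := by
  obtain ⟨N, hN⟩ := lam.exists_part_eq_zero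
  rw [lam.size_eq_sum_range hN, mu.size_eq_sum_range (N := N)
    fun i hi => Nat.eq_zero_of_le_zero (hN i hi ▸ h i)]
  exact Finset.sum_le_sum fun i _ => h i

theorem eq_of_size_eq {mu lam : Ptn} (h : ∀ i, mu.part i ≤ lam.part i) (hs : mu.size = lam.size) :
    mu = lam := by
  obtain ⟨N, hN⟩ := lam.exists_part_eq_zero
  have hN' : ∀ i, N ≤ i → mu.part i = 0 := fun i hi => Nat.eq_zero_of_le_zero (hN i hi ▸ h i)
  rw [lam.size_eq_sum_range hN, mu.size_eq_sum_range hN',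
    Finset.sum_eq_sum_iff_of_le fun i _ => h i] at hs
  refine ext_part fun i => ?_
  by_cases hi : i < N
  · exact hs i (Finset.mem_range.2 hi)
  · rw [hN i (by omega), hN' i (by omega)]

end Ptn

namespace HStrip

theorem refl (mu : Ptn) : HStrip mu mu := fun i => ⟨le_rfl, mu.part_antitone i.le_succ⟩

theorem size_le {mu lam : Ptn} (h : HStrip mu lam) : mu.size ≤ lam.size :=
  Ptn.size_le_size fun i => (h i).1

theorem eq_of_size_eq {mu lam : Ptn} (h : HStrip mu lam) (hs : mu.size = lam.size) : mu = lam :=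
  Ptn.eq_of_size_eq (fun i => (h i).1) hs

/-- Partitions `λ ≻ μ, ν` correspond to pairs `(n, κ)` with `κ ≺ μ, ν`, by reflecting each part of
`λ` but the first in the interval of its admissible values. -/
noncomputable def reflectEquiv (mu nu : Ptn) :
    {lam // HStrip mu lam ∧ HStrip nu lam} ≃ ℕ × {kap // HStrip kap mu ∧ HStrip kap nu} where
  toFun lam := (lam.1.part 0 - max (mu.part 0) (nu.part 0),
    ⟨Ptn.ofParts (fun i => max (mu.part (i + 1)) (nu.part (i + 1)) +
        min (mu.part i) (nu.part i) - lam.1.part (i + 1))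
      (fun i => by
        have h1 := lam.2.1 (i + 1)
        have h2 := lam.2.2 (i + 1)
        have h3 := lam.2.1 i
        have h4 := lam.2.2 i
        have h5 := lam.2.1 (i + 1 + 1)
        have h6 := lam.2.2 (i + 1 + 1)
        omega)
      (by
        obtain ⟨N, hN⟩ := mu.exists_part_eq_zero
        obtain ⟨N', hN'⟩ := nu.exists_part_eq_zero
        refine ⟨max N N', fun i hi => ?_⟩
        have h1 := hN i (by omega)
        have h2 := hN (i + 1) (by omega)
        have h3 := hN' i (by omega)
        have h4 := hN' (i + 1) (by omega)
        omega), by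
      constructor <;> intro i <;> rw [Ptn.part_ofParts] <;> have h1 := lam.2.1 (i + 1) <;>
        have h2 := lam.2.2 (i + 1) <;> have h3 := lam.2.1 i <;> have h4 := lam.2.2 i <;> omega⟩)
  invFun p := ⟨Ptn.ofParts (fun i => match i with
      | 0 => p.1 + max (mu.part 0) (nu.part 0)
      | i + 1 => max (mu.part (i + 1)) (nu.part (i + 1)) +
          min (mu.part i) (nu.part i) - p.2.1.part i)
      (fun i => by
        cases i with
        | zero =>
          have h3 := p.2.2.1 0
          have h4 := p.2.2.2 0
          simp only [zero_add] at *
          omega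
        | succ i =>
          have h1 := p.2.2.1 (i + 1)
          have h2 := p.2.2.2 (i + 1)
          have h3 := p.2.2.1 i
          have h4 := p.2.2.2 i
          simp only
          omega)
      (by
        obtain ⟨N, hN⟩ := mu.exists_part_eq_zero
        obtain ⟨N', hN'⟩ := nu.exists_part_eq_zero
        refine ⟨max N N' + 1, fun i hi => ?_⟩
        obtain ⟨i, rfl⟩ : ∃ j, i = j + 1 := ⟨i - 1, by omega⟩
        have h1 := hN i (by omega)
        have h2 := hN (i + 1) (by omega)
        have h3 := hN' i (by omega)
        have h4 := hN' (i + 1) (by omega)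
        simp only
        omega), by
      constructor <;> intro i <;> rw [Ptn.part_ofParts, Ptn.part_ofParts] <;> cases i with
        | zero =>
          have h3 := p.2.2.1 0
          have h4 := p.2.2.2 0
          simp only [zero_add] at *
          omega
        | succ i =>
          have h1 := p.2.2.1 (i + 1)
          have h2 := p.2.2.2 (i + 1)
          have h3 := p.2.2.1 i
          have h4 := p.2.2.2 i
          simp only
          omega⟩
  left_inv lam := by
    refine Subtype.ext (Ptn.ext_part fun i => ?_)
    rw [Ptn.part_ofParts]
    cases i with
    | zero =>
      have h3 := lam.2.1 0
      have h4 := lam.2.2 0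
      simp only
      omega
    | succ i =>
      have h1 := lam.2.1 (i + 1)
      have h2 := lam.2.2 (i + 1)
      have h3 := lam.2.1 i
      have h4 := lam.2.2 i
      simp only [Ptn.part_ofParts]
      omega
  right_inv p := by
    refine Prod.ext (by simp) (Subtype.ext (Ptn.ext_part fun i => ?_))
    have h3 := p.2.2.1 i
    have h4 := p.2.2.2 i
    simp only [Ptn.part_ofParts]
    omega

theorem size_add_size_reflectEquiv {mu nu : Ptn}
    (lam : {lam // HStrip mu lam ∧ HStrip nu lam}) :
    lam.1.size + (reflectEquiv mu nu lam).2.1.size =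
      (reflectEquiv mu nu lam).1 + mu.size + nu.size := by
  obtain ⟨N, hN⟩ := mu.exists_part_eq_zero
  obtain ⟨N', hN'⟩ := nu.exists_part_eq_zero
  obtain ⟨N'', hN''⟩ := lam.1.exists_part_eq_zero
  set M := max N (max N' N'') with hM
  have hk := (reflectEquiv mu nu lam).2.2.1
  rw [lam.1.size_eq_sum_range (N := M + 1) fun i hi => hN'' i (by omega),
    mu.size_eq_sum_range (N := M) fun i hi => hN i (by omega),
    nu.size_eq_sum_range (N := M) fun i hi => hN' i (by omega),
    Ptn.size_eq_sum_range _ (N := M) fun i hi => by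
      have := (hk i).1
      have := hN i (by omega)
      omega]
  have hparts : ∀ i, lam.1.part (i + 1) + (reflectEquiv mu nu lam).2.1.part i =
      max (mu.part (i + 1)) (nu.part (i + 1)) + min (mu.part i) (nu.part i) := by
    intro i
    have h3 := lam.2.1 i
    have h4 := lam.2.2 i
    have h1 := lam.2.1 (i + 1)
    have h2 := lam.2.2 (i + 1)
    simp only [reflectEquiv, Equiv.coe_fn_mk, Ptn.part_ofParts]
    omega
  have hfst : (reflectEquiv mu nu lam).1 + max (mu.part 0) (nu.part 0) = lam.1.part 0 := by
    have h3 := lam.2.1 0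
    have h4 := lam.2.2 0
    simp only [reflectEquiv, Equiv.coe_fn_mk]
    omega
  have hmax := Finset.sum_range_succ' (fun i => max (mu.part i) (nu.part i)) M
  rw [Finset.sum_range_succ, hN M (by omega), hN' M (by omega), max_self, add_zero] at hmax
  have hsum : ∑ i ∈ Finset.range M, max (mu.part i) (nu.part i) +
      ∑ i ∈ Finset.range M, min (mu.part i) (nu.part i) =
      ∑ i ∈ Finset.range M, mu.part i + ∑ i ∈ Finset.range M, nu.part i := by
    rw [← Finset.sum_add_distrib, ← Finset.sum_add_distrib]
    exact Finset.sum_congr rfl fun i _ => max_add_min _ _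
  have htail : ∑ i ∈ Finset.range M, lam.1.part (i + 1) +
      ∑ i ∈ Finset.range M, (reflectEquiv mu nu lam).2.1.part i =
      ∑ i ∈ Finset.range M, max (mu.part (i + 1)) (nu.part (i + 1)) +
      ∑ i ∈ Finset.range M, min (mu.part i) (nu.part i) := by
    rw [← Finset.sum_add_distrib, ← Finset.sum_add_distrib]
    exact Finset.sum_congr rfl fun i _ => hparts i
  rw [Finset.sum_range_succ']
  omega

end HStrip

/-! ### Transfer operators -/

section transfer

variable {σ : Type*}

open Classical in
/-- The skew Schur function `s_{λ/μ}(x)` in a single variable. -/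
noncomputable def stripWeight (x : MvPowerSeries σ ℝ≥0∞) (lam mu : Ptn) : MvPowerSeries σ ℝ≥0∞ :=
  if HStrip mu lam then x ^ (lam.size - mu.size) else 0

theorem stripWeight_mul (a x : MvPowerSeries σ ℝ≥0∞) (lam mu : Ptn) :
    a ^ lam.size * stripWeight x lam mu = stripWeight (a * x) lam mu * a ^ mu.size := by
  unfold stripWeight
  split_ifs with h
  · obtain ⟨k, hk⟩ := Nat.exists_eq_add_of_le h.size_le
    rw [hk, Nat.add_sub_cancel_left]
    ring
  · simp

theorem AgreeUpTo.stripWeight {m : σ →₀ ℕ} {x y : MvPowerSeries σ ℝ≥0∞} (h : AgreeUpTo m x y)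
    (lam mu : Ptn) : AgreeUpTo m (stripWeight x lam mu) (stripWeight y lam mu) := by
  unfold _root_.stripWeight
  split_ifs
  · exact h.pow _
  · exact refl 0

theorem formalSum_stripWeight_mul (x y : MvPowerSeries σ ℝ≥0∞) (mu nu : Ptn) :
    (formalSum fun lam => stripWeight y lam nu * stripWeight x lam mu) =
      geom (x * y) * formalSum fun kap => stripWeight x nu kap * stripWeight y mu kap := by
  classical
  have h1 : ∀ lam, stripWeight y lam nu * stripWeight x lam mu =
      if HStrip mu lam ∧ HStrip nu lam then
        y ^ (lam.size - nu.size) * x ^ (lam.size - mu.size) else 0 := by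
    intro lam
    unfold stripWeight
    by_cases h : HStrip mu lam <;> by_cases h' : HStrip nu lam <;> simp [h, h']
  have h2 : ∀ kap, stripWeight x nu kap * stripWeight y mu kap =
      if HStrip kap mu ∧ HStrip kap nu then
        x ^ (nu.size - kap.size) * y ^ (mu.size - kap.size) else 0 := by
    intro kap
    unfold stripWeight
    by_cases h : HStrip kap mu <;> by_cases h' : HStrip kap nu <;> simp [h, h']
  simp only [h1, h2]
  rw [formalSum_ite, formalSum_ite, geom, ← formalSum_mul_right]
  simp only [← formalSum_mul_left]
  rw [← formalSum_prod fun p : ℕ × {kap // HStrip kap mu ∧ HStrip kap nu} =>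
      (x * y) ^ p.1 * (x ^ (nu.size - p.2.1.size) * y ^ (mu.size - p.2.1.size)),
    ← formalSum_equiv (HStrip.reflectEquiv mu nu)]
  congr 1
  funext lam
  have h := HStrip.size_add_size_reflectEquiv lam
  have hm := (HStrip.reflectEquiv mu nu lam).2.2.1.size_le
  have hn := (HStrip.reflectEquiv mu nu lam).2.2.2.size_le
  have hx : lam.1.size - mu.size = (HStrip.reflectEquiv mu nu lam).1 +
      (nu.size - (HStrip.reflectEquiv mu nu lam).2.1.size) := by omega
  have hy : lam.1.size - nu.size = (HStrip.reflectEquiv mu nu lam).1 +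
      (mu.size - (HStrip.reflectEquiv mu nu lam).2.1.size) := by omega
  rw [hx, hy]
  ring

theorem formalSum_stripWeight (x : MvPowerSeries σ ℝ≥0∞) (mu : Ptn) :
    (formalSum fun lam => stripWeight x lam mu) =
      geom x * formalSum fun kap => stripWeight x mu kap := by
  have h1 : ∀ lam, stripWeight (1 : MvPowerSeries σ ℝ≥0∞) lam mu * stripWeight x lam mu =
      stripWeight x lam mu := by
    intro lam
    unfold stripWeight
    split_ifs <;> simp
  have h2 : ∀ kap, stripWeight x mu kap * stripWeight (1 : MvPowerSeries σ ℝ≥0∞) mu kap =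
      stripWeight x mu kap := by
    intro kap
    unfold stripWeight
    split_ifs <;> simp
  simpa only [h1, h2, mul_one] using formalSum_stripWeight_mul x 1 mu mu

/-- The operator adding a horizontal strip, with weight recorded by `x`. -/
noncomputable def raise (x : MvPowerSeries σ ℝ≥0∞) (v : Ptn → MvPowerSeries σ ℝ≥0∞) :
    Ptn → MvPowerSeries σ ℝ≥0∞ := fun lam => formalSum fun mu => stripWeight x lam mu * v mu

/-- The operator removing a horizontal strip, with weight recorded by `x`. -/
noncomputable def lower (x : MvPowerSeries σ ℝ≥0∞) (v : Ptn → MvPowerSeries σ ℝ≥0∞) :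
    Ptn → MvPowerSeries σ ℝ≥0∞ := fun lam => formalSum fun mu => stripWeight x mu lam * v mu

theorem raise_smul (x a : MvPowerSeries σ ℝ≥0∞) (v : Ptn → MvPowerSeries σ ℝ≥0∞) :
    raise x (a • v) = a • raise x v := by
  funext lam
  simp only [raise, Pi.smul_apply, smul_eq_mul, mul_left_comm _ a, formalSum_mul_left]

theorem lower_smul (x a : MvPowerSeries σ ℝ≥0∞) (v : Ptn → MvPowerSeries σ ℝ≥0∞) :
    lower x (a • v) = a • lower x v := by
  funext lam
  simp only [lower, Pi.smul_apply, smul_eq_mul, mul_left_comm _ a, formalSum_mul_left]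

theorem lower_raise (x y : MvPowerSeries σ ℝ≥0∞) (v : Ptn → MvPowerSeries σ ℝ≥0∞) :
    lower y (raise x v) = geom (x * y) • raise x (lower y v) := by
  funext nu
  calc lower y (raise x v) nu
      = formalSum fun mu => formalSum fun lam =>
          stripWeight y lam nu * stripWeight x lam mu * v mu := by
        rw [formalSum_comm]
        simp only [lower, raise, mul_assoc, formalSum_mul_left]
    _ = formalSum fun mu => geom (x * y) * formalSum fun kap =>
          stripWeight x nu kap * stripWeight y mu kap * v mu := by
        congr 1
        funext mu
        rw [formalSum_mul_right, formalSum_stripWeight_mul, mul_assoc, ← formalSum_mul_right]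
    _ = (geom (x * y) • raise x (lower y v)) nu := by
        rw [formalSum_mul_left, formalSum_comm]
        simp only [lower, raise, mul_assoc, formalSum_mul_left, Pi.smul_apply, smul_eq_mul]

theorem lower_one (x : MvPowerSeries σ ℝ≥0∞) : lower x 1 = geom x • raise x 1 := by
  funext mu
  simp only [lower, raise, Pi.one_apply, mul_one, Pi.smul_apply, smul_eq_mul]
  exact formalSum_stripWeight x mu

/-- The operator of adding horizontal strips, applied for the last entry of the list first. -/
noncomputable def raiseList (xs : List (MvPowerSeries σ ℝ≥0∞)) (v : Ptn → MvPowerSeries σ ℝ≥0∞) :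
    Ptn → MvPowerSeries σ ℝ≥0∞ := xs.foldr raise v

/-- The product `∏ (1 - x y)⁻¹` over the entries of a list, for fixed `y`. -/
noncomputable def cauchyRow (y : MvPowerSeries σ ℝ≥0∞) (xs : List (MvPowerSeries σ ℝ≥0∞)) :
    MvPowerSeries σ ℝ≥0∞ := (xs.map fun x => geom (x * y)).prod

theorem lower_raiseList (y : MvPowerSeries σ ℝ≥0∞) (xs : List (MvPowerSeries σ ℝ≥0∞))
    (v : Ptn → MvPowerSeries σ ℝ≥0∞) :
    lower y (raiseList xs v) = cauchyRow y xs • raiseList xs (lower y v) := by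
  induction xs with
  | nil => simp [raiseList, cauchyRow]
  | cons x xs ih =>
    change lower y (raise x (raiseList xs v)) = _
    rw [lower_raise, ih, raise_smul, smul_smul]
    simp [raiseList, cauchyRow]

theorem raiseList_smul (xs : List (MvPowerSeries σ ℝ≥0∞)) (a : MvPowerSeries σ ℝ≥0∞)
    (v : Ptn → MvPowerSeries σ ℝ≥0∞) : raiseList xs (a • v) = a • raiseList xs v := by
  induction xs with
  | nil => rfl
  | cons x xs ih =>
    change raise x (raiseList xs (a • v)) = _
    rw [ih, raise_smul]
    rfl

theorem lower_raiseList_one (y : MvPowerSeries σ ℝ≥0∞) (xs : List (MvPowerSeries σ ℝ≥0∞)) :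
    lower y (raiseList xs 1) = (cauchyRow y xs * geom y) • raiseList (xs ++ [y]) 1 := by
  rw [lower_raiseList, lower_one, raiseList_smul, smul_smul, raiseList, raiseList, List.foldr_append]
  rfl

end transfer

/-! ### Products over lists -/

section lists

variable {σ : Type*}

/-- `∏ (1 - x y)⁻¹` over the entries `x` and `y` of two lists. -/
noncomputable def psiList (xs ys : List (MvPowerSeries σ ℝ≥0∞)) : MvPowerSeries σ ℝ≥0∞ :=
  (ys.map fun y => cauchyRow y xs).prod

/-- `∏ᵢ (1 - xᵢ)⁻¹ ∏_{i<j} (1 - xᵢ xⱼ)⁻¹` over the entries of a list. -/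
noncomputable def phiList : List (MvPowerSeries σ ℝ≥0∞) → MvPowerSeries σ ℝ≥0∞
  | [] => 1
  | x :: xs => geom x * cauchyRow x xs * phiList xs

theorem cauchyRow_append (y : MvPowerSeries σ ℝ≥0∞) (xs xs' : List (MvPowerSeries σ ℝ≥0∞)) :
    cauchyRow y (xs ++ xs') = cauchyRow y xs * cauchyRow y xs' := by
  simp [cauchyRow]

theorem cauchyRow_cons (y x : MvPowerSeries σ ℝ≥0∞) (xs : List (MvPowerSeries σ ℝ≥0∞)) :
    cauchyRow y (x :: xs) = geom (x * y) * cauchyRow y xs := by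
  simp [cauchyRow]

theorem cauchyRow_perm (y : MvPowerSeries σ ℝ≥0∞) {xs xs' : List (MvPowerSeries σ ℝ≥0∞)}
    (h : xs.Perm xs') : cauchyRow y xs = cauchyRow y xs' := (h.map _).prod_eq

theorem psiList_cons_left (x : MvPowerSeries σ ℝ≥0∞) (xs ys : List (MvPowerSeries σ ℝ≥0∞)) :
    psiList (x :: xs) ys = cauchyRow x ys * psiList xs ys := by
  unfold psiList
  simp only [cauchyRow_cons, List.prod_map_mul]
  rw [cauchyRow]
  simp only [mul_comm]

theorem psiList_cons_right (y : MvPowerSeries σ ℝ≥0∞) (xs ys : List (MvPowerSeries σ ℝ≥0∞)) :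
    psiList xs (y :: ys) = cauchyRow y xs * psiList xs ys := by
  simp [psiList]

theorem psiList_nil_left (ys : List (MvPowerSeries σ ℝ≥0∞)) : psiList [] ys = 1 := by
  simp [psiList, cauchyRow]

theorem psiList_nil_right (xs : List (MvPowerSeries σ ℝ≥0∞)) : psiList xs [] = 1 := by
  simp [psiList]

theorem psiList_append_left (xs xs' ys : List (MvPowerSeries σ ℝ≥0∞)) :
    psiList (xs ++ xs') ys = psiList xs ys * psiList xs' ys := by
  simp only [psiList, cauchyRow_append, List.prod_map_mul]

theorem psiList_append_right (xs ys ys' : List (MvPowerSeries σ ℝ≥0∞)) :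
    psiList xs (ys ++ ys') = psiList xs ys * psiList xs ys' := by
  simp [psiList]

theorem psiList_perm_left {xs xs' : List (MvPowerSeries σ ℝ≥0∞)} (h : xs.Perm xs')
    (ys : List (MvPowerSeries σ ℝ≥0∞)) : psiList xs ys = psiList xs' ys := by
  simp only [psiList, cauchyRow_perm _ h]

theorem phiList_append (xs ys : List (MvPowerSeries σ ℝ≥0∞)) :
    phiList (xs ++ ys) = phiList xs * phiList ys * psiList xs ys := by
  induction xs with
  | nil => simp [phiList, psiList_nil_left]
  | cons x xs ih =>
    rw [List.cons_append, phiList, phiList, ih, cauchyRow_append, psiList_cons_left]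
    ring

theorem phiList_perm {xs ys : List (MvPowerSeries σ ℝ≥0∞)} (h : xs.Perm ys) :
    phiList xs = phiList ys := by
  induction h with
  | nil => rfl
  | cons x h ih => rw [phiList, phiList, ih, cauchyRow_perm x h]
  | swap x y l =>
    simp only [phiList, cauchyRow_cons]
    rw [mul_comm x y]
    ring
  | trans _ _ h1 h2 => rw [h1, h2]

end lists

/-! ### Sums weighted by size -/

section sizeSum

variable {σ : Type*} (z : MvPowerSeries σ ℝ≥0∞)

/-- The sum `∑ z^{|λ|} v(λ)`. -/
noncomputable def sizeSum (v : Ptn → MvPowerSeries σ ℝ≥0∞) : MvPowerSeries σ ℝ≥0∞ :=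
  formalSum fun lam => z ^ lam.size * v lam

theorem sizeSum_smul (a : MvPowerSeries σ ℝ≥0∞) (v : Ptn → MvPowerSeries σ ℝ≥0∞) :
    sizeSum z (a • v) = a * sizeSum z v := by
  simp only [sizeSum, Pi.smul_apply, smul_eq_mul, mul_left_comm _ a, formalSum_mul_left]

theorem sizeSum_raise (x : MvPowerSeries σ ℝ≥0∞) (v : Ptn → MvPowerSeries σ ℝ≥0∞) :
    sizeSum z (raise x v) = geom (z * x) * sizeSum z (lower (z * (z * x)) v) := by
  calc sizeSum z (raise x v)
      = formalSum fun mu => formalSum fun lam => z ^ lam.size * stripWeight x lam mu * v mu := by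
        rw [formalSum_comm]
        simp only [sizeSum, raise, mul_assoc, formalSum_mul_left]
    _ = formalSum fun mu => geom (z * x) * formalSum fun kap =>
          z ^ kap.size * (stripWeight (z * (z * x)) mu kap * v mu) := by
        congr 1
        funext mu
        simp only [stripWeight_mul, formalSum_mul_right, formalSum_stripWeight]
        rw [mul_assoc, mul_assoc, ← formalSum_mul_right]
        congr 2
        funext kap
        rw [← mul_assoc, mul_comm _ (z ^ mu.size), stripWeight_mul]
        ring
    _ = geom (z * x) * sizeSum z (lower (z * (z * x)) v) := by
        rw [formalSum_mul_left, formalSum_comm]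
        simp only [sizeSum, lower, formalSum_mul_left]

theorem sizeSum_raiseList_cons (x : MvPowerSeries σ ℝ≥0∞) (xs : List (MvPowerSeries σ ℝ≥0∞)) :
    sizeSum z (raiseList (x :: xs) 1) = geom (z * x) * geom (z * (z * x)) *
      cauchyRow (z * (z * x)) xs * sizeSum z (raiseList (xs ++ [z * (z * x)]) 1) := by
  change sizeSum z (raise x (raiseList xs 1)) = _
  rw [sizeSum_raise, lower_raiseList_one, sizeSum_smul]
  ring

theorem sizeSum_raiseList_append (xs ys : List (MvPowerSeries σ ℝ≥0∞)) :
    sizeSum z (raiseList (xs ++ ys.map (z ^ 2 * ·)) 1) =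
      phiList (xs.map (z * ·)) * phiList (xs.map (z ^ 2 * ·)) *
        psiList (xs.map (z ^ 2 * ·)) (ys.map (z ^ 2 * ·)) *
        sizeSum z (raiseList ((ys ++ xs).map (z ^ 2 * ·)) 1) := by
  induction xs generalizing ys with
  | nil => simp [phiList, psiList_nil_left]
  | cons x xs ih =>
    have h := ih (ys ++ [x])
    simp only [List.map_append, List.map_cons, List.map_nil, List.append_assoc, List.cons_append,
      List.nil_append, psiList_append_right, psiList_cons_right] at h ⊢
    have hz : z * (z * x) = z ^ 2 * x := by ring
    rw [sizeSum_raiseList_cons, hz, List.append_assoc, h, phiList, phiList, psiList_cons_left,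
      cauchyRow_append]
    have h1 : cauchyRow (z * x) (xs.map (z * ·)) = cauchyRow (z ^ 2 * x) xs := by
      simp only [cauchyRow, List.map_map, Function.comp_def]
      congr! 4
      ring
    rw [h1, psiList_nil_right]
    ring

theorem sizeSum_raiseList (xs : List (MvPowerSeries σ ℝ≥0∞)) (K : ℕ) :
    sizeSum z (raiseList xs 1) =
      (∏ k ∈ Finset.range (2 * K), phiList (xs.map (z ^ (k + 1) * ·))) *
        sizeSum z (raiseList (xs.map (z ^ (2 * K) * ·)) 1) := by
  induction K with
  | zero => simp
  | succ K ih =>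
    have h := sizeSum_raiseList_append z (xs.map (z ^ (2 * K) * ·)) []
    simp only [List.map_nil, List.append_nil, List.nil_append, List.map_map, Function.comp_def,
      ← mul_assoc, ← pow_succ', ← pow_add] at h
    rw [ih, h, show 2 * (K + 1) = 2 * K + 1 + 1 by ring, Finset.prod_range_succ,
      Finset.prod_range_succ, show 2 + 2 * K = 2 * K + 1 + 1 by ring]
    rw [psiList_nil_right]
    ring

theorem raise_zero (v : Ptn → MvPowerSeries σ ℝ≥0∞) : raise 0 v = v := by
  funext lam
  rw [raise, formalSum_eq_single _ lam]
  · simp [stripWeight, HStrip.refl]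
  · intro mu hmu
    unfold stripWeight
    split_ifs with h
    · rw [zero_pow, zero_mul]
      have := h.size_le
      have : mu.size ≠ lam.size := fun hs => hmu (h.eq_of_size_eq hs)
      omega
    · rw [zero_mul]

theorem AgreeUpTo.raiseList_one {m : σ →₀ ℕ} {xs : List (MvPowerSeries σ ℝ≥0∞)}
    (h : ∀ x ∈ xs, AgreeUpTo m x 0) (lam : Ptn) : AgreeUpTo m (raiseList xs 1 lam) 1 := by
  induction xs generalizing lam with
  | nil => exact refl 1
  | cons x xs ih =>
    have h1 : AgreeUpTo m (raise x (raiseList xs 1) lam) (raise 0 1 lam) :=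
      formalSum fun mu => ((h x (by simp)).stripWeight lam mu).mul
        (ih (fun y hy => h y (by simp [hy])) mu)
    rwa [raise_zero] at h1

namespace Ptn

theorem part_eq_zero_of_le {lam : Ptn} {i j : ℕ} (h : lam.part i = 0) (hij : i ≤ j) :
    lam.part j = 0 := by
  have := lam.part_antitone hij
  omega

/-- Subtracting the smallest part from each of `K + 1` parts. -/
noncomputable def firstColumnsEquiv (K : ℕ) :
    {lam : Ptn // lam.part (K + 1) = 0} ≃ ℕ × {lam : Ptn // lam.part K = 0} where
  toFun lam := (lam.1.part K, ⟨ofParts (fun i => lam.1.part i - lam.1.part K)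
    (fun i => Nat.sub_le_sub_right (lam.1.part_antitone i.le_succ) _)
    ⟨K, fun i hi => Nat.sub_eq_zero_of_le (lam.1.part_antitone hi)⟩, by simp⟩)
  invFun p := ⟨ofParts (fun i => if i ≤ K then p.2.1.part i + p.1 else 0)
    (fun i => by
      have := p.2.1.part_antitone (Nat.le_add_right i 1)
      split_ifs <;> omega)
    ⟨K + 1, fun i hi => if_neg (by omega)⟩, by simp⟩
  left_inv lam := by
    refine Subtype.ext (ext_part fun i => ?_)
    simp only [part_ofParts]
    split_ifs with h
    · have := lam.1.part_antitone h
      omega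
    · have := lam.1.part_antitone (show K + 1 ≤ i by omega)
      have := lam.2
      omega
  right_inv p := by
    have hK := p.2.2
    refine Prod.ext (by simp [hK]) (Subtype.ext (ext_part fun i => ?_))
    simp only [part_ofParts, le_refl, if_true]
    split_ifs with h
    · omega
    · have := p.2.1.part_antitone (show K ≤ i by omega)
      omega

theorem size_eq_firstColumnsEquiv (K : ℕ) (lam : {lam : Ptn // lam.part (K + 1) = 0}) :
    lam.1.size = (K + 1) * (firstColumnsEquiv K lam).1 + (firstColumnsEquiv K lam).2.1.size := by
  have h0 : ∀ i, K + 1 ≤ i → lam.1.part i = 0 := fun i hi => part_eq_zero_of_le lam.2 hi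
  have h1 : ∀ i, K + 1 ≤ i → (firstColumnsEquiv K lam).2.1.part i = 0 := fun i hi =>
    part_eq_zero_of_le (firstColumnsEquiv K lam).2.2 (by omega)
  rw [size_eq_sum_range _ h0, size_eq_sum_range _ h1]
  have h2 : ∀ i ∈ Finset.range (K + 1), lam.1.part i =
      (firstColumnsEquiv K lam).1 + (firstColumnsEquiv K lam).2.1.part i := by
    intro i hi
    have := lam.1.part_antitone (Nat.lt_succ_iff.1 (Finset.mem_range.1 hi))
    simp only [firstColumnsEquiv, Equiv.coe_fn_mk, part_ofParts]
    omega
  rw [Finset.sum_congr rfl h2, Finset.sum_add_distrib]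
  simp

theorem le_size_of_part_ne_zero {lam : Ptn} {K : ℕ} (h : lam.part K ≠ 0) : K + 1 ≤ lam.size := by
  obtain ⟨N, hN⟩ := lam.exists_part_eq_zero
  have hKN : K + 1 ≤ N := by
    by_contra hlt
    exact h (hN K (by omega))
  rw [lam.size_eq_sum_range hN]
  calc K + 1 = ∑ i ∈ Finset.range (K + 1), 1 := by simp
    _ ≤ ∑ i ∈ Finset.range (K + 1), lam.part i := Finset.sum_le_sum fun i hi => by
        have := lam.part_antitone (Nat.lt_succ_iff.1 (Finset.mem_range.1 hi))
        omega
    _ ≤ ∑ i ∈ Finset.range N, lam.part i :=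
        Finset.sum_le_sum_of_subset (Finset.range_subset_range.2 hKN)

end Ptn

theorem formalSum_pow_size (K : ℕ) :
    (formalSum fun lam : {lam : Ptn // lam.part K = 0} => z ^ lam.1.size) =
      ∏ k ∈ Finset.range K, geom (z ^ (k + 1)) := by
  induction K with
  | zero =>
    let e : Ptn := ⟨0, fun _ _ _ => le_rfl⟩
    rw [formalSum_eq_single _ ⟨e, rfl⟩]
    · simp [e, Ptn.size]
    · rintro ⟨lam, hlam⟩ hne
      refine absurd (Subtype.ext (Ptn.ext_part fun i => ?_)) hne
      exact Ptn.part_eq_zero_of_le hlam i.zero_le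
  | succ K ih =>
    rw [Finset.prod_range_succ, ← ih, mul_comm, geom, ← formalSum_mul_right]
    simp only [← formalSum_mul_left]
    rw [← formalSum_prod fun p : ℕ × {lam : Ptn // lam.part K = 0} =>
        (z ^ (K + 1)) ^ p.1 * z ^ p.2.1.size, ← formalSum_equiv (Ptn.firstColumnsEquiv K)]
    congr 1
    funext lam
    rw [Ptn.size_eq_firstColumnsEquiv K lam, pow_add, pow_mul]

variable {z}

theorem AgreeUpTo.sizeSum_one {m : σ →₀ ℕ} {K : ℕ} (h : AgreeUpTo m (z ^ K) 0) :
    AgreeUpTo m (sizeSum z 1) (∏ k ∈ Finset.range K, geom (z ^ (k + 1))) := by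
  classical
  rw [← formalSum_pow_size, ← formalSum_ite (fun lam : Ptn => lam.part K = 0)
    fun lam => z ^ lam.size]
  refine formalSum fun lam => ?_
  rw [Pi.one_apply, mul_one]
  split_ifs with h0
  · exact refl _
  · obtain ⟨k, hk⟩ := Nat.exists_eq_add_of_le (Ptn.le_size_of_part_ne_zero h0)
    rw [hk, add_assoc, pow_add]
    exact h.zero_mul

theorem AgreeUpTo.sizeSum_raiseList {m : σ →₀ ℕ} {K : ℕ} (h : AgreeUpTo m (z ^ K) 0)
    (xs : List (MvPowerSeries σ ℝ≥0∞)) :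
    AgreeUpTo m (sizeSum z (raiseList xs 1)) (∏ k ∈ Finset.range (2 * K),
      (phiList (xs.map (z ^ (k + 1) * ·)) * geom (z ^ (k + 1)))) := by
  have h2 : AgreeUpTo m (z ^ (2 * K)) 0 := by
    rw [two_mul, pow_add]
    exact h.zero_mul
  rw [_root_.sizeSum_raiseList z xs K, Finset.prod_mul_distrib]
  refine (refl _).mul (AgreeUpTo.trans ?_ (sizeSum_one h2))
  refine formalSum fun lam => (refl _).mul (raiseList_one (fun x hx => ?_) lam)
  obtain ⟨y, -, rfl⟩ := List.mem_map.1 hx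
  exact h2.zero_mul

end sizeSum

/-! ### Skew Schur functions with extended nonnegative coefficients -/

namespace IsSchurChain

theorem prod_eq {R : Type*} [CommMonoid R] {lam : Ptn} {c : ℕ → Ptn} {N : ℕ}
    (hN : ∀ i, N ≤ i → c i = lam) (X : ℕ → R) :
    ∏ᶠ i, X i ^ ((c (i + 1)).size - (c i).size) =
      ∏ i ∈ Finset.range N, X i ^ ((c (i + 1)).size - (c i).size) := by
  refine finprod_eq_prod_of_mulSupport_subset _ fun i hi => ?_
  rw [Finset.coe_range, Set.mem_Iio]
  by_contra h
  refine hi ?_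
  beta_reduce
  rw [hN i (by omega), hN (i + 1) (by omega), Nat.sub_self, pow_zero]

/-- A chain is determined by its first step and the remaining chain. -/
def consEquiv (mu lam : Ptn) :
    {c // IsSchurChain mu lam c} ≃
      Σ kap : {kap // HStrip mu kap}, {c // IsSchurChain kap.1 lam c} where
  toFun c := ⟨⟨c.1 1, by simpa only [c.2.1] using c.2.2.1 0⟩, ⟨fun i => c.1 (i + 1), rfl, fun i => c.2.2.1 (i + 1),
    c.2.2.2.imp fun N hN i hi => hN (i + 1) (by omega)⟩⟩
  invFun p := ⟨fun i => match i with
      | 0 => mu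
      | i + 1 => p.2.1 i, rfl,
    fun i => by
      cases i with
      | zero => simpa only [p.2.2.1] using p.1.2
      | succ i => exact p.2.2.2.1 i, by
    obtain ⟨N, hN⟩ := p.2.2.2.2
    refine ⟨N + 1, fun i hi => ?_⟩
    obtain ⟨j, rfl⟩ : ∃ j, i = j + 1 := ⟨i - 1, by omega⟩
    exact hN j (by omega)⟩
  left_inv c := by
    refine Subtype.ext (funext fun i => ?_)
    cases i with
    | zero => exact c.2.1.symm
    | succ i => rfl
  right_inv := by
    rintro ⟨⟨kap, hkap⟩, c, hc0, hc⟩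
    change c 0 = kap at hc0
    subst hc0
    rfl

end IsSchurChain

section skewSeries

variable {σ : Type*}

/-- The skew Schur function `s_{λ/μ}(X)` with coefficients in `[0, ∞]`. -/
noncomputable def skewSeries (X : ℕ → MvPowerSeries σ ℝ≥0∞) (lam mu : Ptn) :
    MvPowerSeries σ ℝ≥0∞ :=
  formalSum fun c : {c : ℕ → Ptn // IsSchurChain mu lam c} =>
    ∏ᶠ i : ℕ, X i ^ ((c.1 (i + 1)).size - (c.1 i).size)

theorem AgreeUpTo.skewSeries {m : σ →₀ ℕ} {X Y : ℕ → MvPowerSeries σ ℝ≥0∞}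
    (h : ∀ n, AgreeUpTo m (X n) (Y n)) (lam mu : Ptn) :
    AgreeUpTo m (skewSeries X lam mu) (skewSeries Y lam mu) := by
  refine formalSum fun c => ?_
  obtain ⟨N, hN⟩ := c.2.2.2
  rw [IsSchurChain.prod_eq hN X, IsSchurChain.prod_eq hN Y]
  exact prod _ fun i _ => (h i).pow _

theorem skewSeries_cons (X : ℕ → MvPowerSeries σ ℝ≥0∞) (lam mu : Ptn) :
    skewSeries X lam mu =
      formalSum fun kap => skewSeries (fun n => X (n + 1)) lam kap * stripWeight (X 0) kap mu := by
  classical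
  have h1 : ∀ kap, skewSeries (fun n => X (n + 1)) lam kap * stripWeight (X 0) kap mu =
      if HStrip mu kap then
        skewSeries (fun n => X (n + 1)) lam kap * X 0 ^ (kap.size - mu.size) else 0 := by
    intro kap
    rw [stripWeight, mul_ite, mul_zero]
  simp only [h1]
  rw [formalSum_ite]
  simp only [skewSeries, ← formalSum_mul_right]
  rw [← formalSum_sigma fun p : (Σ kap : {kap // HStrip mu kap},
      {c // IsSchurChain kap.1 lam c}) => (∏ᶠ i : ℕ, X (i + 1) ^
        ((p.2.1 (i + 1)).size - (p.2.1 i).size)) * X 0 ^ (p.1.1.size - mu.size),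
    ← formalSum_equiv (IsSchurChain.consEquiv mu lam)]
  congr 1
  funext c
  obtain ⟨N, hN⟩ := c.2.2.2
  change _ = (∏ᶠ i, X (i + 1) ^ ((c.1 (i + 1 + 1)).size - (c.1 (i + 1)).size)) *
    X 0 ^ ((c.1 1).size - mu.size)
  rw [IsSchurChain.prod_eq (N := N + 1) (fun i hi => hN i (by omega)) X,
    Finset.prod_range_succ', IsSchurChain.prod_eq (c := fun i => c.1 (i + 1)) (N := N)
      (fun i hi => hN (i + 1) (by omega)) fun i => X (i + 1), c.2.1]

theorem IsSchurChain.eq_of_prod_zero_ne_zero {R : Type*} [CommSemiring R]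
    {mu lam : Ptn} {c : ℕ → Ptn} (hc : IsSchurChain mu lam c)
    (h : ∏ᶠ i, (0 : R) ^ ((c (i + 1)).size - (c i).size) ≠ 0) (i : ℕ) : c i = mu := by
  obtain ⟨hc0, hc, N, hN⟩ := hc
  rw [IsSchurChain.prod_eq hN fun _ => (0 : R)] at h
  induction i with
  | zero => exact hc0
  | succ i ih =>
    rw [← ih]
    by_cases hi : i < N
    · refine ((hc i).eq_of_size_eq ?_).symm
      have hle := (hc i).size_le
      by_contra hlt
      exact h (Finset.prod_eq_zero (Finset.mem_range.2 hi) (zero_pow (by omega)))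
    · rw [hN i (by omega), hN (i + 1) (by omega)]

theorem skewSeries_zero_self (lam : Ptn) :
    skewSeries (fun _ => (0 : MvPowerSeries σ ℝ≥0∞)) lam lam = 1 := by
  rw [skewSeries, formalSum_eq_single _ ⟨fun _ => lam, rfl, fun _ => HStrip.refl lam, 0,
    fun _ _ => rfl⟩]
  · simp
  · intro c hne
    by_contra hprod
    exact hne (Subtype.ext (funext (c.2.eq_of_prod_zero_ne_zero hprod)))

theorem skewSeries_zero_of_ne {lam mu : Ptn} (h : lam ≠ mu) :
    skewSeries (fun _ => (0 : MvPowerSeries σ ℝ≥0∞)) lam mu = 0 := by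
  have hc : ∀ c : {c : ℕ → Ptn // IsSchurChain mu lam c},
      ∏ᶠ i, (0 : MvPowerSeries σ ℝ≥0∞) ^ ((c.1 (i + 1)).size - (c.1 i).size) = 0 := by
    intro c
    by_contra hprod
    obtain ⟨N, hN⟩ := c.2.2.2
    exact h ((hN N le_rfl).symm.trans (c.2.eq_of_prod_zero_ne_zero hprod N))
  ext d
  simp [skewSeries, coeff_formalSum, hc]

/-- The operator with matrix `s_{λ/μ}(X)`. -/
noncomputable def raiseAll (X : ℕ → MvPowerSeries σ ℝ≥0∞) (v : Ptn → MvPowerSeries σ ℝ≥0∞) :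
    Ptn → MvPowerSeries σ ℝ≥0∞ := fun lam => formalSum fun mu => skewSeries X lam mu * v mu

/-- The operator with matrix `s_{μ/λ}(X)`. -/
noncomputable def lowerAll (X : ℕ → MvPowerSeries σ ℝ≥0∞) (v : Ptn → MvPowerSeries σ ℝ≥0∞) :
    Ptn → MvPowerSeries σ ℝ≥0∞ := fun lam => formalSum fun mu => skewSeries X mu lam * v mu

theorem raiseAll_zero (v : Ptn → MvPowerSeries σ ℝ≥0∞) : raiseAll (fun _ => 0) v = v := by
  funext lam
  rw [raiseAll, formalSum_eq_single _ lam, skewSeries_zero_self, one_mul]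
  intro mu h
  rw [skewSeries_zero_of_ne h.symm, zero_mul]

theorem lowerAll_zero (v : Ptn → MvPowerSeries σ ℝ≥0∞) : lowerAll (fun _ => 0) v = v := by
  funext lam
  rw [lowerAll, formalSum_eq_single _ lam, skewSeries_zero_self, one_mul]
  intro mu h
  rw [skewSeries_zero_of_ne h, zero_mul]

theorem raiseAll_cons (X : ℕ → MvPowerSeries σ ℝ≥0∞) (v : Ptn → MvPowerSeries σ ℝ≥0∞) :
    raiseAll X v = raiseAll (fun n => X (n + 1)) (raise (X 0) v) := by
  funext lam
  simp only [raiseAll, raise, skewSeries_cons X, ← formalSum_mul_right, ← formalSum_mul_left]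
  rw [formalSum_comm]
  simp only [mul_assoc]

theorem lowerAll_cons (X : ℕ → MvPowerSeries σ ℝ≥0∞) (v : Ptn → MvPowerSeries σ ℝ≥0∞) :
    lowerAll X v = lower (X 0) (lowerAll (fun n => X (n + 1)) v) := by
  funext lam
  simp only [lowerAll, lower, skewSeries_cons X, ← formalSum_mul_right, ← formalSum_mul_left]
  rw [formalSum_comm]
  simp only [mul_left_comm, mul_assoc]

theorem raiseAll_eq_raiseList {X : ℕ → MvPowerSeries σ ℝ≥0∞} {N : ℕ} (hX : ∀ n, N ≤ n → X n = 0)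
    (v : Ptn → MvPowerSeries σ ℝ≥0∞) :
    raiseAll X v = raiseList ((List.range N).map X).reverse v := by
  induction N generalizing X v with
  | zero =>
    rw [show X = fun _ => 0 from funext fun n => hX n n.zero_le, raiseAll_zero]
    rfl
  | succ N ih =>
    rw [raiseAll_cons, ih fun n hn => hX (n + 1) (by omega), List.range_succ_eq_map]
    simp [raiseList, Function.comp_def]

theorem lowerAll_eq_foldr {X : ℕ → MvPowerSeries σ ℝ≥0∞} {N : ℕ} (hX : ∀ n, N ≤ n → X n = 0)
    (v : Ptn → MvPowerSeries σ ℝ≥0∞) :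
    lowerAll X v = ((List.range N).map X).foldr lower v := by
  induction N generalizing X v with
  | zero =>
    rw [show X = fun _ => 0 from funext fun n => hX n n.zero_le, lowerAll_zero]
    rfl
  | succ N ih =>
    rw [lowerAll_cons, ih fun n hn => hX (n + 1) (by omega), List.range_succ_eq_map]
    simp [Function.comp_def]

theorem foldr_lower_smul (ys : List (MvPowerSeries σ ℝ≥0∞)) (a : MvPowerSeries σ ℝ≥0∞)
    (v : Ptn → MvPowerSeries σ ℝ≥0∞) : ys.foldr lower (a • v) = a • ys.foldr lower v := by
  induction ys with
  | nil => rfl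
  | cons y ys ih => rw [List.foldr_cons, ih, lower_smul, List.foldr_cons]

theorem foldr_lower_raiseList (ys us : List (MvPowerSeries σ ℝ≥0∞)) :
    ys.foldr lower (raiseList us 1) =
      (phiList ys * psiList us ys) • raiseList (us ++ ys.reverse) 1 := by
  induction ys with
  | nil => simp [phiList, psiList_nil_right]
  | cons y ys ih =>
    rw [List.foldr_cons, ih, lower_smul, lower_raiseList_one, smul_smul, phiList,
      psiList_cons_right, cauchyRow_append, cauchyRow_perm y ys.reverse_perm, List.append_assoc,
      List.reverse_cons]
    congr 1
    ring

end skewSeries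

/-! ### Paths of partitions along a profile -/

section paths

variable {σ : Type*}

/-- The sum over all paths `λ⁰, …, λʰ` ending at a given partition of the product of the
weights `M i λⁱ⁺¹ λⁱ`. -/
noncomputable def pathSum (M : ℕ → Ptn → Ptn → MvPowerSeries σ ℝ≥0∞) :
    ℕ → Ptn → MvPowerSeries σ ℝ≥0∞
  | 0 => 1
  | h + 1 => fun lam => formalSum fun mu => M h lam mu * pathSum M h mu

theorem formalSum_path (M : ℕ → Ptn → Ptn → MvPowerSeries σ ℝ≥0∞) (h : ℕ)
    (g : Ptn → MvPowerSeries σ ℝ≥0∞) :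
    (formalSum fun L : Fin (h + 1) → Ptn =>
      g (L (Fin.last h)) * ∏ i : Fin h, M i (L i.succ) (L i.castSucc)) =
      formalSum fun lam => g lam * pathSum M h lam := by
  induction h generalizing g with
  | zero =>
    rw [← formalSum_equiv (Equiv.funUnique (Fin 1) Ptn)]
    simp [pathSum]
  | succ h ih =>
    rw [← formalSum_equiv (Fin.snocEquiv fun _ : Fin (h + 1 + 1) => Ptn), formalSum_prod]
    congr 1
    funext lam
    rw [pathSum, ← formalSum_mul_left]
    simp only [← mul_assoc]
    rw [← ih fun mu => g lam * M h lam mu]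
    congr 1
    funext L
    rw [Fin.prod_univ_castSucc]
    simp only [Fin.snocEquiv, Equiv.coe_fn_mk, Fin.snoc_last, Fin.snoc_castSucc, Fin.succ_last,
      ← Fin.castSucc_succ, Fin.val_castSucc, Fin.val_last]
    ring

theorem AgreeUpTo.pathSum {m : σ →₀ ℕ} {M M' : ℕ → Ptn → Ptn → MvPowerSeries σ ℝ≥0∞}
    (h : ∀ i lam mu, AgreeUpTo m (M i lam mu) (M' i lam mu)) (n : ℕ) (lam : Ptn) :
    AgreeUpTo m (pathSum M n lam) (pathSum M' n lam) := by
  induction n generalizing lam with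
  | zero => exact refl _
  | succ n ih => exact formalSum fun mu => (h n lam mu).mul (ih mu)

/-- The matrix of the `i`-th step along the profile `δ` with alphabets `X`. -/
noncomputable def profileStep (δ : ℕ → ℤ) (X : ℕ → ℕ → MvPowerSeries σ ℝ≥0∞) (i : ℕ)
    (lam mu : Ptn) : MvPowerSeries σ ℝ≥0∞ :=
  if δ (i + 1) = 1 then skewSeries (X (i + 1)) lam mu else skewSeries (X (i + 1)) mu lam

/-- The first `N` variables of each of the alphabets `X 1, …, X h` whose index satisfies `p`. -/
def blockList {R : Type*} (X : ℕ → ℕ → R) (N : ℕ) (p : ℕ → Prop) [DecidablePred p] (h : ℕ) :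
    List R :=
  (List.range h).flatMap fun i => if p (i + 1) then (List.range N).map (X (i + 1)) else []

theorem blockList_succ {R : Type*} (X : ℕ → ℕ → R) (N : ℕ) (p : ℕ → Prop) [DecidablePred p]
    (h : ℕ) : blockList X N p (h + 1) =
      blockList X N p h ++ if p (h + 1) then (List.range N).map (X (h + 1)) else [] := by
  rw [blockList, List.range_succ, List.flatMap_append, List.flatMap_singleton]
  rfl

theorem blockList_perm {R : Type*} (X : ℕ → ℕ → R) (N : ℕ) (p : ℕ → Prop) [DecidablePred p]
    (h : ℕ) : (blockList X N p h ++ blockList X N (fun i => ¬ p i) h).Perm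
      (blockList X N (fun _ => True) h) := by
  induction h with
  | zero => exact List.Perm.refl _
  | succ h ih =>
    simp only [blockList_succ]
    by_cases hp : p (h + 1)
    · simp only [hp, if_true, not_true, if_false, List.append_nil]
      rw [List.append_assoc]
      refine (List.perm_append_comm.append_left _).trans ?_
      rw [← List.append_assoc]
      exact ih.append_right _
    · simp only [hp, if_true, not_false_iff, if_false, List.append_nil]
      rw [← List.append_assoc]
      exact ih.append_right _

theorem pathSum_profileStep {δ : ℕ → ℤ} {X : ℕ → ℕ → MvPowerSeries σ ℝ≥0∞} {N : ℕ}
    (hX : ∀ i n, N ≤ n → X i n = 0) (h : ℕ) :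
    ∃ us : List (MvPowerSeries σ ℝ≥0∞), us.Perm (blockList X N (fun _ => True) h) ∧
      pathSum (profileStep δ X) h =
        ((∏ j ∈ Finset.range h, if δ (j + 1) = 1 then 1 else
            psiList (blockList X N (fun i => δ i = 1) j) ((List.range N).map (X (j + 1)))) *
          phiList (blockList X N (fun i => ¬ δ i = 1) h)) • raiseList us 1 := by
  induction h with
  | zero => exact ⟨[], List.Perm.refl _, by simp [pathSum, blockList, phiList, raiseList]⟩
  | succ h ih =>
    obtain ⟨us, hus, ih⟩ := ih
    rw [pathSum, ih]
    by_cases hδ : δ (h + 1) = 1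
    · refine ⟨((List.range N).map (X (h + 1))).reverse ++ us, ?_, ?_⟩
      · rw [blockList_succ, if_pos trivial]
        exact List.perm_append_comm.trans (hus.append (List.reverse_perm _))
      · simp only [profileStep, hδ, if_true]
        change raiseAll _ _ = _
        rw [raiseAll_eq_raiseList (hX (h + 1)), raiseList_smul, Finset.prod_range_succ,
          blockList_succ, if_pos hδ, if_neg (not_not.2 hδ), List.append_nil, mul_one]
        simp only [raiseList, List.foldr_append]
    · refine ⟨us ++ ((List.range N).map (X (h + 1))).reverse, ?_, ?_⟩
      · rw [blockList_succ, if_pos trivial]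
        exact hus.append (List.reverse_perm _)
      · simp only [profileStep, hδ, if_false]
        change lowerAll _ _ = _
        rw [lowerAll_eq_foldr (hX (h + 1)), foldr_lower_smul, foldr_lower_raiseList, smul_smul,
          Finset.prod_range_succ, blockList_succ, if_neg hδ, if_pos hδ, phiList_append,
          psiList_perm_left (hus.trans (blockList_perm X N (fun i => δ i = 1) h).symm),
          psiList_append_left]
        congr 1
        ring

theorem AgreeUpTo.sizeSum_pathSum {m : σ →₀ ℕ} {δ : ℕ → ℤ} {X : ℕ → ℕ → MvPowerSeries σ ℝ≥0∞}
    {z : MvPowerSeries σ ℝ≥0∞} {K N : ℕ} (hz : AgreeUpTo m (z ^ K) 0)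
    (hX : ∀ i n, N ≤ n → AgreeUpTo m (X i n) 0) (h : ℕ) :
    AgreeUpTo m (sizeSum z (_root_.pathSum (profileStep δ X) h))
      ((∏ j ∈ Finset.range h, if δ (j + 1) = 1 then 1 else
            psiList (blockList X N (fun i => δ i = 1) j) ((List.range N).map (X (j + 1)))) *
          phiList (blockList X N (fun i => ¬ δ i = 1) h) *
        ∏ k ∈ Finset.range (2 * K), (phiList ((blockList X N (fun _ => True) h).map
          (z ^ (k + 1) * ·)) * geom (z ^ (k + 1)))) := by
  let Y : ℕ → ℕ → MvPowerSeries σ ℝ≥0∞ := fun i n => if n < N then X i n else 0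
  have hXY : ∀ i n, AgreeUpTo m (X i n) (Y i n) := by
    intro i n
    by_cases hn : n < N
    · simpa only [Y, hn, if_true] using refl _
    · simpa only [Y, hn, if_false] using hX i n (by omega)
  have hmap : ∀ i, (List.range N).map (X i) = (List.range N).map (Y i) := fun i =>
    List.map_congr_left fun n hn => (if_pos (List.mem_range.1 hn)).symm
  have hblock : ∀ (p : ℕ → Prop) [DecidablePred p] j, blockList X N p j = blockList Y N p j := by
    intro p _ j
    simp only [blockList, hmap]
  simp only [hblock, hmap]
  obtain ⟨us, hus, heq⟩ := pathSum_profileStep (δ := δ) (X := Y) (N := N)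
    (fun i n hn => if_neg (by omega)) h
  have h1 : AgreeUpTo m (sizeSum z (_root_.pathSum (profileStep δ X) h))
      (sizeSum z (_root_.pathSum (profileStep δ Y) h)) := by
    refine formalSum fun lam => (refl _).mul (AgreeUpTo.pathSum (fun i lam mu => ?_) h lam)
    unfold profileStep
    split_ifs
    · exact skewSeries (hXY _) _ _
    · exact skewSeries (hXY _) _ _
  refine h1.trans ?_
  rw [heq, sizeSum_smul]
  refine (refl _).mul ?_
  simpa only [phiList_perm (hus.map _)] using sizeSum_raiseList hz us

end paths

/-! ### Finiteness of coefficients -/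

section finiteness

variable {σ : Type*}

/-- All coefficients of `f` are finite. -/
def FiniteCoeffs (f : MvPowerSeries σ ℝ≥0∞) : Prop := ∀ d, coeff d f ≠ ⊤

namespace FiniteCoeffs

theorem one : FiniteCoeffs (1 : MvPowerSeries σ ℝ≥0∞) := by
  classical
  intro d
  rw [coeff_one]
  split_ifs <;> simp

theorem mul {f g : MvPowerSeries σ ℝ≥0∞} (hf : FiniteCoeffs f) (hg : FiniteCoeffs g) :
    FiniteCoeffs (f * g) := by
  classical
  intro d
  rw [coeff_mul]
  exact ENNReal.sum_ne_top.2 fun p _ => ENNReal.mul_ne_top (hf _) (hg _)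

theorem pow {f : MvPowerSeries σ ℝ≥0∞} (hf : FiniteCoeffs f) (n : ℕ) : FiniteCoeffs (f ^ n) := by
  induction n with
  | zero => simpa using one
  | succ n ih => simpa only [pow_succ] using ih.mul hf

theorem prod {ι : Type*} {f : ι → MvPowerSeries σ ℝ≥0∞} (s : Finset ι)
    (h : ∀ i ∈ s, FiniteCoeffs (f i)) : FiniteCoeffs (∏ i ∈ s, f i) :=
  Finset.prod_induction f FiniteCoeffs (fun _ _ => mul) one h

theorem list_prod {l : List (MvPowerSeries σ ℝ≥0∞)} (h : ∀ f ∈ l, FiniteCoeffs f) :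
    FiniteCoeffs l.prod :=
  List.prod_induction FiniteCoeffs (fun _ _ => mul) one h

theorem cauchyRow {y : MvPowerSeries σ ℝ≥0∞} {xs : List (MvPowerSeries σ ℝ≥0∞)}
    (hy : FiniteCoeffs y) (hxs : ∀ x ∈ xs, FiniteCoeffs x ∧ constantCoeff x = 0) :
    FiniteCoeffs (cauchyRow y xs) := by
  refine list_prod fun f hf => ?_
  obtain ⟨x, hx, rfl⟩ := List.mem_map.1 hf
  refine coeff_geom_ne_top ?_ (by simp [(hxs x hx).2])
  exact (hxs x hx).1.mul hy

theorem psiList {xs ys : List (MvPowerSeries σ ℝ≥0∞)}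
    (hxs : ∀ x ∈ xs, FiniteCoeffs x ∧ constantCoeff x = 0) (hys : ∀ y ∈ ys, FiniteCoeffs y) :
    FiniteCoeffs (psiList xs ys) := by
  refine list_prod fun f hf => ?_
  obtain ⟨y, hy, rfl⟩ := List.mem_map.1 hf
  exact cauchyRow (hys y hy) hxs

theorem phiList {xs : List (MvPowerSeries σ ℝ≥0∞)}
    (hxs : ∀ x ∈ xs, FiniteCoeffs x ∧ constantCoeff x = 0) : FiniteCoeffs (phiList xs) := by
  induction xs with
  | nil => exact one
  | cons x xs ih =>
    rw [List.forall_mem_cons] at hxs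
    exact (mul (coeff_geom_ne_top hxs.1.1 hxs.1.2) (cauchyRow hxs.1.1 hxs.2)).mul (ih hxs.2)

end FiniteCoeffs

theorem FiniteCoeffs.sizeSum_pathSum {z : MvPowerSeries σ ℝ≥0∞}
    {X : ℕ → ℕ → MvPowerSeries σ ℝ≥0∞} (hz : FiniteCoeffs z) (hz0 : constantCoeff z = 0)
    (hX : ∀ i n, FiniteCoeffs (X i n) ∧ constantCoeff (X i n) = 0)
    (hzm : ∀ m, ∃ K, AgreeUpTo m (z ^ K) 0)
    (hXm : ∀ m, ∃ N, ∀ i n, N ≤ n → AgreeUpTo m (X i n) 0) (δ : ℕ → ℤ) (h : ℕ) :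
    FiniteCoeffs (sizeSum z (pathSum (profileStep δ X) h)) := by
  intro d
  obtain ⟨K, hK⟩ := hzm d
  obtain ⟨N, hN⟩ := hXm d
  rw [AgreeUpTo.sizeSum_pathSum hK hN h d le_rfl]
  have hmap : ∀ i, ∀ x ∈ (List.range N).map (X i), FiniteCoeffs x ∧ constantCoeff x = 0 := by
    intro i x hx
    obtain ⟨n, -, rfl⟩ := List.mem_map.1 hx
    exact hX i n
  have hblock : ∀ (p : ℕ → Prop) [DecidablePred p] j, ∀ x ∈ blockList X N p j,
      FiniteCoeffs x ∧ constantCoeff x = 0 := by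
    intro p _ j x hx
    obtain ⟨i, -, hx⟩ := List.mem_flatMap.1 hx
    split_ifs at hx
    · exact hmap _ x hx
    · simp at hx
  refine ((prod _ fun j _ => ?_).mul (phiList (hblock _ _))).mul (prod _ fun k _ => ?_) d
  · split_ifs
    · exact one
    · exact psiList (hblock _ _) fun y hy => (hmap _ y hy).1
  · refine (phiList fun x hx => ?_).mul (coeff_geom_ne_top (hz.pow _) (by simp [hz0]))
    obtain ⟨y, hy, rfl⟩ := List.mem_map.1 hx
    exact ⟨(hz.pow _).mul (hblock _ _ y hy).1, by simp [hz0]⟩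

end finiteness

/-! ### Infinite products of power series -/

section products

variable {σ ι : Type*} {m : σ →₀ ℕ}

theorem AgreeUpTo.prod_subset {f : ι → MvPowerSeries σ ℚ} {s t : Finset ι} (hst : s ⊆ t)
    (hs : ∀ i, i ∉ s → AgreeUpTo m (f i) 1) : AgreeUpTo m (∏ i ∈ t, f i) (∏ i ∈ s, f i) := by
  classical
  rw [← Finset.prod_sdiff hst]
  have h1 : AgreeUpTo m (∏ i ∈ t \ s, f i) (∏ i ∈ t \ s, 1) :=
    prod _ fun i hi => hs i (Finset.mem_sdiff.1 hi).2
  simpa using h1.mul (refl (∏ i ∈ s, f i))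

theorem AgreeUpTo.tprod {f : ι → MvPowerSeries σ ℚ}
    (hf : ∀ m, ∃ s : Finset ι, ∀ i, i ∉ s → AgreeUpTo m (f i) 1) {s : Finset ι}
    (hs : ∀ i, i ∉ s → AgreeUpTo m (f i) 1) : AgreeUpTo m (∏' i, f i) (∏ i ∈ s, f i) := by
  classical
  choose S hS using hf
  let g : MvPowerSeries σ ℚ := fun d => coeff d (∏ i ∈ S d, f i)
  have hg : HasProd f g := by
    refine tendsto_pi_nhds.2 fun d => tendsto_const_nhds.congr' ?_
    filter_upwards [Filter.eventually_ge_atTop (S d)] with t ht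
    exact (prod_subset ht (hS d) d le_rfl).symm
  rw [hg.tprod_eq]
  intro d hd
  change coeff d (∏ i ∈ S d, f i) = _
  rw [← prod_subset Finset.subset_union_left (hS d) d le_rfl,
    prod_subset (Finset.subset_union_right (s₁ := S d)) hs d hd]

theorem AgreeUpTo.inv_one_sub {f : MvPowerSeries σ ℚ} (h : AgreeUpTo m f 0)
    (h0 : constantCoeff f = 0) : AgreeUpTo m (1 - f)⁻¹ 1 := by
  have h1 : (1 - f)⁻¹ * (1 - f) = 1 := MvPowerSeries.inv_mul_cancel _ (by simp [h0])
  have h2 : AgreeUpTo m ((1 - f)⁻¹ * (1 - f)) ((1 - f)⁻¹ * (1 - 0)) := (refl _).mul h.one_sub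
  rw [h1, sub_zero, mul_one] at h2
  exact h2.symm

/-- Up to the exponent `m`, `f` and `g` are the images of one power series over `ℕ`. -/
def SameNatUpTo (m : σ →₀ ℕ) (f : MvPowerSeries σ ℚ) (g : MvPowerSeries σ ℝ≥0∞) : Prop :=
  ∃ f', AgreeUpTo m f f' ∧ SameNatSeries f' g

namespace SameNatUpTo

theorem mul {f f' : MvPowerSeries σ ℚ} {g g' : MvPowerSeries σ ℝ≥0∞} (h : SameNatUpTo m f g)
    (h' : SameNatUpTo m f' g') : SameNatUpTo m (f * f') (g * g') := by
  obtain ⟨a, ha, hg⟩ := h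
  obtain ⟨b, hb, hg'⟩ := h'
  exact ⟨a * b, ha.mul hb, hg.mul hg'⟩

theorem prod {f : ι → MvPowerSeries σ ℚ} {g : ι → MvPowerSeries σ ℝ≥0∞} (s : Finset ι)
    (h : ∀ i ∈ s, SameNatUpTo m (f i) (g i)) :
    SameNatUpTo m (∏ i ∈ s, f i) (∏ i ∈ s, g i) := by
  classical
  induction s using Finset.induction_on with
  | empty => exact ⟨1, .refl 1, .one⟩
  | insert i s hi ih =>
    rw [Finset.prod_insert hi, Finset.prod_insert hi]
    exact (h i (by simp)).mul (ih fun j hj => h j (by simp [hj]))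

theorem tprod {f : ι → MvPowerSeries σ ℚ} {g : ι → MvPowerSeries σ ℝ≥0∞}
    (hf : ∀ m, ∃ s : Finset ι, ∀ i, i ∉ s → AgreeUpTo m (f i) 1) {s : Finset ι}
    (hs : ∀ i, i ∉ s → AgreeUpTo m (f i) 1) (hg : ∀ i ∈ s, SameNatUpTo m (f i) (g i)) :
    SameNatUpTo m (∏' i, f i) (∏ i ∈ s, g i) := by
  obtain ⟨f', hf', hg'⟩ := prod s hg
  exact ⟨f', (AgreeUpTo.tprod hf hs).trans hf', hg'⟩

theorem agreeUpTo_one {f : MvPowerSeries σ ℚ} (h : SameNatUpTo m f 1) : AgreeUpTo m f 1 := by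
  obtain ⟨f', hf', hg⟩ := h
  refine hf'.trans fun d _ => hg.coeff_eq_of_coeff_eq .one rfl

end SameNatUpTo

/-- `X` is a summable alphabet over `ℚ` without constant terms, and `Y` is the same alphabet
over `[0, ∞]`. -/
structure SameAlphabet (X : ℕ → MvPowerSeries σ ℚ) (Y : ℕ → MvPowerSeries σ ℝ≥0∞) : Prop where
  same : ∀ n, SameNatSeries (X n) (Y n)
  constantCoeff_eq_zero : ∀ n, constantCoeff (X n) = 0
  exists_agreeUpTo_zero : ∀ m, ∃ N, ∀ n, N ≤ n → AgreeUpTo m (X n) 0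

theorem SameNatUpTo.psi {X X' : ℕ → MvPowerSeries σ ℚ} {Y Y' : ℕ → MvPowerSeries σ ℝ≥0∞}
    (h : SameAlphabet X Y) (h' : SameAlphabet X' Y') {N : ℕ}
    (hN : ∀ n, N ≤ n → AgreeUpTo m (X n) 0) (hN' : ∀ n, N ≤ n → AgreeUpTo m (X' n) 0) :
    SameNatUpTo m (Psi X X') (psiList ((List.range N).map Y) ((List.range N).map Y')) := by
  have hprod : psiList ((List.range N).map Y) ((List.range N).map Y') =
      ∏ p ∈ Finset.range N ×ˢ Finset.range N, geom (Y p.1 * Y' p.2) := by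
    rw [Finset.prod_product_right, psiList, List.map_map]
    simp only [cauchyRow, Function.comp_def, List.map_map]
    rfl
  have hone : ∀ {m : σ →₀ ℕ} {N N' : ℕ}, (∀ n, N ≤ n → AgreeUpTo m (X n) 0) →
      (∀ n, N' ≤ n → AgreeUpTo m (X' n) 0) → ∀ p : ℕ × ℕ,
      p ∉ Finset.range N ×ˢ Finset.range N' → AgreeUpTo m (1 - X p.1 * X' p.2)⁻¹ 1 := by
    intro m N N' hN hN' p hp
    refine AgreeUpTo.inv_one_sub ?_ (by simp [h.constantCoeff_eq_zero])
    rw [Finset.mem_product, Finset.mem_range, Finset.mem_range] at hp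
    by_cases h1 : p.1 < N
    · exact (hN' _ (by omega)).mul_zero
    · exact (hN _ (by omega)).zero_mul
  rw [hprod]
  refine tprod (fun m => ?_) (hone hN hN') fun p _ => ⟨_, .refl _, SameNatSeries.inv_one_sub
    ((h.same _).mul (h'.same _)) (by simp [h.constantCoeff_eq_zero])⟩
  obtain ⟨N, hN⟩ := h.exists_agreeUpTo_zero m
  obtain ⟨N', hN'⟩ := h'.exists_agreeUpTo_zero m
  exact ⟨_, hone hN hN'⟩

theorem phiList_map_range (Y : ℕ → MvPowerSeries σ ℝ≥0∞) (N : ℕ) :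
    phiList ((List.range N).map Y) = (∏ i ∈ Finset.range N, geom (Y i)) *
      ∏ j ∈ Finset.range N, ∏ i ∈ Finset.range j, geom (Y i * Y j) := by
  induction N with
  | zero => simp [phiList]
  | succ N ih =>
    have h1 : psiList ((List.range N).map Y) [Y N] = ∏ i ∈ Finset.range N, geom (Y i * Y N) := by
      simp only [psiList, cauchyRow, List.map_map, List.map_cons, List.map_nil,
        List.prod_cons, List.prod_nil, mul_one]
      rfl
    rw [List.range_succ, List.map_append, phiList_append, ih, List.map_singleton, h1,
      Finset.prod_range_succ, Finset.prod_range_succ]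
    simp only [phiList, cauchyRow, List.map_nil, List.prod_nil, mul_one]
    ring

theorem SameNatUpTo.phi {X : ℕ → MvPowerSeries σ ℚ} {Y : ℕ → MvPowerSeries σ ℝ≥0∞}
    (h : SameAlphabet X Y) {N : ℕ} (hN : ∀ n, N ≤ n → AgreeUpTo m (X n) 0) :
    SameNatUpTo m (Phi X) (phiList ((List.range N).map Y)) := by
  let s : ℕ → Finset {q : ℕ × ℕ // q.1 < q.2} := fun N =>
    (Finset.range N ×ˢ Finset.range N).subtype _
  have hprod : ∏ j ∈ Finset.range N, ∏ i ∈ Finset.range j, geom (Y i * Y j) =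
      ∏ p ∈ s N, geom (Y p.1.1 * Y p.1.2) := by
    rw [Finset.prod_subtype_eq_prod_filter (f := fun p : ℕ × ℕ => geom (Y p.1 * Y p.2)),
      Finset.prod_filter, Finset.prod_product_right]
    refine Finset.prod_congr rfl fun j hj => ?_
    rw [← Finset.prod_filter]
    refine Finset.prod_congr ?_ fun _ _ => rfl
    ext i
    simp only [Finset.mem_range, Finset.mem_filter] at hj ⊢
    omega
  have hone : ∀ {m : σ →₀ ℕ} {N : ℕ}, (∀ n, N ≤ n → AgreeUpTo m (X n) 0) →
      ∀ i, i ∉ Finset.range N → AgreeUpTo m (1 - X i)⁻¹ 1 := by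
    intro m N hN i hi
    exact (hN i (by simpa using hi)).inv_one_sub (h.constantCoeff_eq_zero i)
  have hone2 : ∀ {m : σ →₀ ℕ} {N : ℕ}, (∀ n, N ≤ n → AgreeUpTo m (X n) 0) →
      ∀ p, p ∉ s N → AgreeUpTo m (1 - X p.1.1 * X p.1.2)⁻¹ 1 := by
    intro m N hN p hp
    refine AgreeUpTo.inv_one_sub ?_ (by simp [h.constantCoeff_eq_zero])
    have hlt := p.2
    simp only [s, Finset.mem_subtype, Finset.mem_product, Finset.mem_range] at hp
    exact (hN _ (by omega)).mul_zero
  rw [phiList_map_range, hprod]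
  refine (tprod (fun m => ?_) (hone hN) fun i _ => ⟨_, .refl _,
    (h.same i).inv_one_sub (h.constantCoeff_eq_zero i)⟩).mul
    (tprod (fun m => ?_) (hone2 hN) fun p _ => ⟨_, .refl _, SameNatSeries.inv_one_sub
      ((h.same _).mul (h.same _)) (by simp [h.constantCoeff_eq_zero])⟩)
  · exact (h.exists_agreeUpTo_zero m).imp' _ fun N hN => hone hN
  · exact (h.exists_agreeUpTo_zero m).imp' _ fun N hN => hone2 hN

end products

/-! ### Regrouping the finite products -/

section regroup

variable {σ : Type*}

theorem blockList_true {R : Type*} (X : ℕ → ℕ → R) (N h : ℕ) :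
    ((List.range (h * N)).map fun n => X (n % h + 1) (n / h)).Perm
      (blockList X N (fun _ => True) h) := by
  rcases h.eq_zero_or_pos with rfl | hh
  · simp [blockList]
  have hperm : ((List.range (h * N)).map fun n => (n % h, n / h)).Perm
      (List.range h ×ˢ List.range N) := by
    refine (List.perm_ext_iff_of_nodup ?_ (List.nodup_range.product List.nodup_range)).2 ?_
    · refine List.Nodup.map (fun a b hab => ?_) List.nodup_range
      rw [Prod.mk.injEq] at hab
      rw [← Nat.mod_add_div a h, ← Nat.mod_add_div b h, hab.1, hab.2]
    · rintro ⟨i, n⟩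
      simp only [List.mem_map, List.mem_range, Prod.mk.injEq, List.mem_product]
      constructor
      · rintro ⟨k, hk, rfl, rfl⟩
        exact ⟨Nat.mod_lt _ hh, Nat.div_lt_of_lt_mul hk⟩
      · rintro ⟨hi, hn⟩
        refine ⟨i + h * n, ?_, ?_, ?_⟩
        · calc i + h * n < h * (n + 1) := by rw [mul_add, mul_one]; omega
            _ ≤ h * N := Nat.mul_le_mul_left h hn
        · rw [Nat.add_mul_mod_self_left, Nat.mod_eq_of_lt hi]
        · rw [Nat.add_mul_div_left _ _ hh, Nat.div_eq_of_lt hi, zero_add]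
  have := hperm.map fun p => X (p.1 + 1) p.2
  simpa [blockList, SProd.sprod, List.product, List.map_flatMap, Function.comp_def] using this

theorem phiList_append_of_eq_zero (xs : List (MvPowerSeries σ ℝ≥0∞))
    {ys : List (MvPowerSeries σ ℝ≥0∞)} (hys : ∀ y ∈ ys, y = 0) :
    phiList (xs ++ ys) = phiList xs := by
  induction ys with
  | nil => rw [List.append_nil]
  | cons y ys ih =>
    rw [List.forall_mem_cons] at hys
    rw [phiList_perm List.perm_middle, phiList, ih hys.2, hys.1]
    simp [cauchyRow, geom_zero]

theorem phiList_blockList (X : ℕ → ℕ → MvPowerSeries σ ℝ≥0∞) (N : ℕ) (p : ℕ → Prop)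
    [DecidablePred p] (h : ℕ) :
    phiList ((List.range (h * N)).map fun n => if p (n % h + 1) then X (n % h + 1) (n / h) else 0) =
      phiList (blockList X N p h) := by
  let Y : ℕ → ℕ → MvPowerSeries σ ℝ≥0∞ := fun i n => if p i then X i n else 0
  change phiList ((List.range (h * N)).map fun n => Y (n % h + 1) (n / h)) = _
  have hXY : blockList Y N p h = blockList X N p h := by
    refine List.flatMap_congr fun i _ => ?_
    by_cases hi : p (i + 1) <;> simp [Y, hi]
  rw [phiList_perm ((blockList_true Y N h).trans (blockList_perm Y N p h).symm),
    phiList_append_of_eq_zero, hXY]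
  intro y hy
  obtain ⟨i, -, hy⟩ := List.mem_flatMap.1 hy
  split_ifs at hy with hi
  · obtain ⟨n, -, rfl⟩ := List.mem_map.1 hy
    exact if_neg hi
  · simp at hy

theorem psiList_blockList (X : ℕ → ℕ → MvPowerSeries σ ℝ≥0∞) (N : ℕ) (p : ℕ → Prop)
    [DecidablePred p] (h : ℕ) (ys : List (MvPowerSeries σ ℝ≥0∞)) :
    psiList (blockList X N p h) ys = ∏ i ∈ Finset.range h,
      if p (i + 1) then psiList ((List.range N).map (X (i + 1))) ys else 1 := by
  induction h with
  | zero => exact psiList_nil_left ys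
  | succ h ih =>
    rw [blockList_succ, psiList_append_left, ih, Finset.prod_range_succ]
    split_ifs
    · rfl
    · rw [psiList_nil_left]

theorem prod_inversions {M : Type*} [CommMonoid M] {h : ℕ} {δ : ℕ → ℤ} (hδ : IsProfile h δ)
    (F : ℕ → ℕ → M) :
    ∏ q ∈ Finset.univ.filter
        (fun q : Fin h × Fin h => q.1 < q.2 ∧ δ ((q.1 : ℕ) + 1) > δ ((q.2 : ℕ) + 1)),
        F q.1 q.2 =
      ∏ j ∈ Finset.range h, if δ (j + 1) = 1 then 1 else
        ∏ i ∈ Finset.range j, if δ (i + 1) = 1 then F i j else 1 := by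
  rw [Finset.prod_filter, Fintype.prod_prod_type_right, Finset.prod_range]
  refine Finset.prod_congr rfl fun j _ => ?_
  have hj := hδ (j + 1) (by omega) (by omega)
  split_ifs with hj1
  · refine Finset.prod_eq_one fun i _ => if_neg ?_
    have hi := hδ ((i : ℕ) + 1) (by omega) (by omega)
    dsimp only
    omega
  · have hrange : Finset.range j = (Finset.range h).filter (· < (j : ℕ)) := by
      ext i
      simp only [Finset.mem_range, Finset.mem_filter]
      omega
    rw [hrange, Finset.prod_filter, Finset.prod_range]
    refine Finset.prod_congr rfl fun i _ => ?_
    have hi := hδ ((i : ℕ) + 1) (by omega) (by omega)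
    dsimp only
    rw [ite_and]
    by_cases hi1 : δ ((i : ℕ) + 1) = 1
    · rw [if_pos (show δ ((i : ℕ) + 1) > δ ((j : ℕ) + 1) by omega), if_pos hi1]
      rfl
    · rw [if_neg (show ¬ δ ((i : ℕ) + 1) > δ ((j : ℕ) + 1) by omega), if_neg hi1]
      rfl

end regroup

/-! ### The formula with rational coefficients -/

section rational

/-- The alphabets `Z^i` with coefficients in `[0, ∞]`. -/
noncomputable def zaSeries (i n : ℕ) : MvPowerSeries ((ℕ × ℕ) ⊕ Unit) ℝ≥0∞ := X (Sum.inl (i, n))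

/-- The variable `z` with coefficients in `[0, ∞]`. -/
noncomputable def zSeries : MvPowerSeries ((ℕ × ℕ) ⊕ Unit) ℝ≥0∞ := X (Sum.inr ())

theorem exists_agreeUpTo_X_zero (R : Type*) [Semiring R] (m : (ℕ × ℕ) ⊕ Unit →₀ ℕ) :
    ∃ N, ∀ i n, N ≤ n → AgreeUpTo m (X (Sum.inl (i, n)) : MvPowerSeries _ R) 0 := by
  refine ⟨(m.support.sup fun s => s.elim Prod.snd fun _ => 0) + 1, fun i n hn => ?_⟩
  refine AgreeUpTo.X_zero ?_
  by_contra h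
  have := Finset.le_sup (f := fun s : (ℕ × ℕ) ⊕ Unit => s.elim Prod.snd fun _ => 0)
    (Finsupp.mem_support_iff.2 h)
  simp only [Sum.elim_inl] at this
  omega

theorem finiteCoeffs_X {σ : Type*} (s : σ) : FiniteCoeffs (X s : MvPowerSeries σ ℝ≥0∞) :=
  (SameNatSeries.X s).coeff_ne_top

theorem finiteCoeffs_sizeSum_pathSum (A : ℕ → ℕ) (δ : ℕ → ℤ) (h : ℕ) :
    FiniteCoeffs (sizeSum zSeries (pathSum (profileStep δ fun i => zaSeries (A i)) h)) := by
  refine FiniteCoeffs.sizeSum_pathSum (finiteCoeffs_X _) (by simp)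
    (fun i n => ⟨finiteCoeffs_X _, by simp⟩)
    (fun m => ⟨m (Sum.inr ()) + 1, AgreeUpTo.X_pow_zero (Nat.lt_succ_self _)⟩) (fun m => ?_) δ h
  obtain ⟨N, hN⟩ := exists_agreeUpTo_X_zero ℝ≥0∞ m
  exact ⟨N, fun i n hn => hN (A i) n hn⟩

theorem finiteCoeffs_skewSeries (i : ℕ) (lam mu : Ptn) :
    FiniteCoeffs (skewSeries (zaSeries i) lam mu) := by
  classical
  intro d
  refine ne_top_of_le_ne_top (finiteCoeffs_sizeSum_pathSum (fun _ => i) (fun _ => 1) 1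
    (Finsupp.single (Sum.inr ()) lam.size + d)) ?_
  rw [sizeSum, coeff_formalSum]
  refine le_trans ?_ (ENNReal.le_tsum lam)
  have hz : zSeries ^ lam.size = monomial (Finsupp.single (Sum.inr ()) lam.size) 1 := by
    rw [zSeries, X_pow_eq]
  rw [hz, coeff_add_monomial_mul, one_mul]
  simp only [pathSum, profileStep, if_true, coeff_formalSum, Pi.one_apply, mul_one]
  exact ENNReal.le_tsum (f := fun mu => coeff d (skewSeries (zaSeries i) lam mu)) mu

theorem sameNatSeries_skewSchur (i : ℕ) (lam mu : Ptn) :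
    SameNatSeries (skewSchur (Za i) lam mu) (skewSeries (zaSeries i) lam mu) := by
  refine SameNatSeries.tsum (fun c => ?_) (finiteCoeffs_skewSeries i lam mu)
  obtain ⟨N, hN⟩ := c.2.2.2
  rw [chainWeight, IsSchurChain.prod_eq hN, IsSchurChain.prod_eq hN]
  exact .prod _ fun n _ => (SameNatSeries.X _).pow _

theorem sameNatSeries_paths (h : ℕ) (δ : ℕ → ℤ) :
    SameNatSeries (∑' L : Fin (h + 1) → Ptn,
      z ^ (L (Fin.last h)).size *
        ∏ i : Fin h,
          (if δ ((i : ℕ) + 1) = 1 then skewSchur (Za ((i : ℕ) + 1)) (L i.succ) (L i.castSucc)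
            else skewSchur (Za ((i : ℕ) + 1)) (L i.castSucc) (L i.succ)))
      (sizeSum zSeries (pathSum (profileStep δ zaSeries) h)) := by
  have hpath := formalSum_path (profileStep δ zaSeries) h fun lam => zSeries ^ lam.size
  have hfin := finiteCoeffs_sizeSum_pathSum id δ h
  rw [sizeSum, ← hpath]
  refine SameNatSeries.tsum (fun L => ?_) fun d => ?_
  · refine ((SameNatSeries.X _).pow _).mul (.prod _ fun i _ => ?_)
    unfold profileStep
    split_ifs
    · exact sameNatSeries_skewSchur _ _ _
    · exact sameNatSeries_skewSchur _ _ _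
  · rw [hpath]
    exact hfin d

theorem sameAlphabet_Za (i : ℕ) : SameAlphabet (Za i) (zaSeries i) where
  same n := .X _
  constantCoeff_eq_zero n := by simp [Za]
  exists_agreeUpTo_zero m := (exists_agreeUpTo_X_zero ℚ m).imp fun _ hN n hn => hN i n hn

theorem agreeUpTo_Za_div {m : (ℕ × ℕ) ⊕ Unit →₀ ℕ} {N h : ℕ}
    (hN : ∀ i n, N ≤ n → AgreeUpTo m (Za i n) 0) (hh : 1 ≤ h) (i n : ℕ) (hn : h * N ≤ n) :
    AgreeUpTo m (Za i (n / h)) 0 :=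
  hN _ _ ((Nat.le_div_iff_mul_le hh).2 (by rwa [mul_comm]))

theorem sameAlphabet_Zminus {h : ℕ} (hh : 1 ≤ h) {δ : ℕ → ℤ} :
    SameAlphabet (Zminus h δ)
      fun n => if δ (n % h + 1) = -1 then zaSeries (n % h + 1) (n / h) else 0 where
  same n := by
    unfold Zminus
    split_ifs
    · exact .X _
    · exact .zero
  constantCoeff_eq_zero n := by
    unfold Zminus
    split_ifs <;> simp [Za]
  exists_agreeUpTo_zero m := by
    obtain ⟨N, hN⟩ := exists_agreeUpTo_X_zero ℚ m
    refine ⟨h * N, fun n hn => ?_⟩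
    unfold Zminus
    split_ifs
    · exact agreeUpTo_Za_div hN hh _ n hn
    · exact .refl 0

theorem sameAlphabet_smul_Zall {h : ℕ} (hh : 1 ≤ h) (k : ℕ) :
    SameAlphabet (fun n => z ^ k * Zall h n)
      fun n => zSeries ^ k * zaSeries (n % h + 1) (n / h) where
  same n := ((SameNatSeries.X _).pow k).mul (.X _)
  constantCoeff_eq_zero n := by simp [Zall, Za]
  exists_agreeUpTo_zero m := by
    obtain ⟨N, hN⟩ := exists_agreeUpTo_X_zero ℚ m
    exact ⟨h * N, fun n hn => (agreeUpTo_Za_div hN hh _ n hn).mul_zero⟩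

theorem sameNatUpTo_phi_smul_Zall {m : (ℕ × ℕ) ⊕ Unit →₀ ℕ} {h N : ℕ} (hh : 1 ≤ h)
    (hN : ∀ i n, N ≤ n → AgreeUpTo m (Za i n) 0) {K : ℕ} (hK : m (Sum.inr ()) < K) :
    SameNatUpTo m (∏' k : ℕ, Phi (fun n => z ^ (k + 1) * Zall h n) * (1 - z ^ (k + 1))⁻¹)
      (∏ k ∈ Finset.range K, (phiList ((blockList zaSeries N (fun _ => True) h).map
        (zSeries ^ (k + 1) * ·)) * geom (zSeries ^ (k + 1)))) := by
  have hone : ∀ {m : (ℕ × ℕ) ⊕ Unit →₀ ℕ} {K : ℕ}, m (Sum.inr ()) < K →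
      ∀ k, k ∉ Finset.range K →
        AgreeUpTo m (Phi (fun n => z ^ (k + 1) * Zall h n) * (1 - z ^ (k + 1))⁻¹) 1 := by
    intro m K hK k hk
    rw [Finset.mem_range] at hk
    have hz : AgreeUpTo m (z ^ (k + 1)) 0 := AgreeUpTo.X_pow_zero (by omega)
    have hphi := SameNatUpTo.phi (sameAlphabet_smul_Zall hh (k + 1)) (N := 0)
      fun n _ => hz.zero_mul
    simpa using (SameNatUpTo.agreeUpTo_one hphi).mul (hz.inv_one_sub (by simp [z]))
  refine SameNatUpTo.tprod (fun m => ⟨_, hone (Nat.lt_succ_self _)⟩) (hone hK) fun k _ => ?_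
  refine SameNatUpTo.mul ?_ ⟨_, .refl _,
    SameNatSeries.inv_one_sub ((SameNatSeries.X _).pow _) (by simp [z])⟩
  have hphi := SameNatUpTo.phi (sameAlphabet_smul_Zall hh (k + 1)) (N := h * N)
    fun n hn => (agreeUpTo_Za_div hN hh _ n hn).mul_zero
  rwa [← phiList_perm ((blockList_true zaSeries N h).map _), List.map_map]

end rational

end helpers

/-- **Complete summation formula in profile form** (Theorem 2.1, equation (2.2)):
for a profile `δ = (δ_1, …, δ_h)`,
`Σ_{λ^0,…,λ^h} z^{|λ^h|} ∏_{i=1}^h s_i^δ(Z^i)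
  = ∏_{1≤i<j≤h, δ_i>δ_j} Ψ(Z^i,Z^j) · Φ(Z^δ_-) · ∏_{k≥1} Φ(z^k Z)/(1-z^k)`,
where `s_i^δ = s_{λ^i/λ^{i-1}}` if `δ_i = 1` and `s_{λ^{i-1}/λ^i}` if `δ_i = -1`. -/
theorem complete_summation_formula_profile (h : ℕ) (hh : 1 ≤ h) (δ : ℕ → ℤ)
    (hδ : IsProfile h δ) :
    ∑' L : Fin (h + 1) → Ptn,
      z ^ (L (Fin.last h)).size *
        ∏ i : Fin h,
          (if δ ((i : ℕ) + 1) = 1 then skewSchur (Za ((i : ℕ) + 1)) (L i.succ) (L i.castSucc)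
            else skewSchur (Za ((i : ℕ) + 1)) (L i.castSucc) (L i.succ))
    = (∏ q ∈ Finset.univ.filter
          (fun q : Fin h × Fin h => q.1 < q.2 ∧ δ ((q.1 : ℕ) + 1) > δ ((q.2 : ℕ) + 1)),
          Psi (Za ((q.1 : ℕ) + 1)) (Za ((q.2 : ℕ) + 1))) *
        Phi (Zminus h δ) *
        ∏' k : ℕ, Phi (fun n => z ^ (k + 1) * Zall h n) * (1 - z ^ (k + 1))⁻¹ := by
  refine MvPowerSeries.ext fun m => ?_
  obtain ⟨N, hN⟩ := exists_agreeUpTo_X_zero ℚ m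
  obtain ⟨N', hN'⟩ := exists_agreeUpTo_X_zero ENNReal m
  replace hN : ∀ i n, max N N' ≤ n → AgreeUpTo m (Za i n) 0 := fun i n hn =>
    hN i n (le_trans (le_max_left _ _) hn)
  replace hN' : ∀ i n, max N N' ≤ n → AgreeUpTo m (zaSeries i n) 0 := fun i n hn =>
    hN' i n (le_trans (le_max_right _ _) hn)
  generalize max N N' = N at hN hN'
  have hz : m (Sum.inr ()) < m (Sum.inr ()) + 1 := Nat.lt_succ_self _
  have hpsi := SameNatUpTo.prod (Finset.univ.filter
      (fun q : Fin h × Fin h => q.1 < q.2 ∧ δ ((q.1 : ℕ) + 1) > δ ((q.2 : ℕ) + 1)))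
    fun q _ => SameNatUpTo.psi (sameAlphabet_Za ((q.1 : ℕ) + 1)) (sameAlphabet_Za ((q.2 : ℕ) + 1))
      (hN _) (hN _)
  rw [prod_inversions hδ fun i j => psiList ((List.range N).map (zaSeries (i + 1)))
    ((List.range N).map (zaSeries (j + 1)))] at hpsi
  simp only [← psiList_blockList zaSeries N (fun i => δ i = 1)] at hpsi
  have hphi := SameNatUpTo.phi (m := m) (N := h * N) (sameAlphabet_Zminus hh (δ := δ))
    fun n hn => by
      unfold Zminus
      split_ifs
      · exact agreeUpTo_Za_div hN hh _ n hn
      · exact .refl 0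
  have hminus : ∀ n, (δ (n % h + 1) = -1) = ¬ δ (n % h + 1) = 1 := fun n => by
    have hn := hδ (n % h + 1) (by omega) (Nat.mod_lt n hh)
    rw [eq_iff_iff]
    omega
  simp only [hminus] at hphi
  rw [phiList_blockList zaSeries N (fun i => ¬ δ i = 1)] at hphi
  obtain ⟨f, hf, hfg⟩ := (hpsi.mul hphi).mul
    (sameNatUpTo_phi_smul_Zall hh hN (K := 2 * (m (Sum.inr ()) + 1)) (by omega))
  rw [hf m le_rfl]
  exact (sameNatSeries_paths h δ).coeff_eq_of_coeff_eq hfg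
    (AgreeUpTo.sizeSum_pathSum (AgreeUpTo.X_pow_zero hz) hN' h m le_rfl)
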